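/- Fix reals ε, b, A > 0 and 0 < λ < 1. There exists a constant c = c(ε, b, A, λ) > 0 such that the following holds. Let C, C' ≥ 1 be reals, let 2 ≤ y ≤ x be reals with (log y)^{ε(1−λ)} ≥ (log log x)², and set z := exp((log y)^{1−λ}). Let f be a real-valued additive function such that #{f(p) : p prime, t < p ≤ t^e} ≤ A for all z ≤ t ≤ y. Let r be a nonnegative real-valued multiplicative function satisfying: max_{p ≤ y} r(p) ≤ A; Σ_{p ≤ y, ν ≥ 2} r(p^ν)·log(p^ν)/p^ν ≤ A; and |Σ_{p ≤ t} r(p)/p − b·log log t| ≤ C for all 2 ≤ t ≤ y. Suppose moreover there exists a nonnegative multiplicative function r̃ with Σ_{p ≤ y} |r(p) − r̃(p)|/p ≤ A and |Σ_{p ≤ t} r̃(p) − b·Li(t)| ≤ A·(C' + t/(log t)^{1+ε}) for all 2 ≤ t ≤ y. Then for every k ∈ ℝ, Σ_{n ∈ S(x,y), f(n)=k} r(n) ≤ c · ((log y)^b / log x) · e^{2C + C'/z} · x / √(E_f(y; r)). -/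

import Mathlib

open scoped Classical

/-- The finset of primes `p ≤ x` for a real `x`. -/
noncomputable def primesBelow (x : ℝ) : Finset ℕ :=
  (Finset.range (⌊x⌋₊ + 1)).filter Nat.Prime

/-- `E_f(x; r) := 1 + ∑_{p ≤ x, f(p) ≠ 0} r(p)/p`. -/
noncomputable def Ef (f : ℕ → ℝ) (x : ℝ) (r : ℕ → ℝ) : ℝ :=
  1 + ∑ p ∈ (primesBelow x).filter (fun p => f p ≠ 0), r p / p

/-- `Li(t) := ∫₂ᵗ du / log u`. -/
noncomputable def Li (t : ℝ) : ℝ := ∫ u in (2:ℝ)..t, 1 / Real.log u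

/-- Comparison of finite sums along an injection. -/
lemma sum_le_sum_inj {ι κ : Type*} (s : Finset ι) (t : Finset κ) (F : ι → ℝ) (G : κ → ℝ)
    (i : ι → κ) (hi : ∀ a ∈ s, i a ∈ t) (hinj : ∀ a ∈ s, ∀ b ∈ s, i a = i b → a = b)
    (hle : ∀ a ∈ s, F a ≤ G (i a)) (hG : ∀ b ∈ t, 0 ≤ G b) :
    ∑ a ∈ s, F a ≤ ∑ b ∈ t, G b := by
  calc ∑ a ∈ s, F a ≤ ∑ a ∈ s, G (i a) := Finset.sum_le_sum hle
    _ = ∑ b ∈ s.image i, G b := by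
        rw [Finset.sum_image]
        intro a ha b hb h
        exact hinj a ha b hb h
    _ ≤ ∑ b ∈ t, G b := by
        apply Finset.sum_le_sum_of_subset_of_nonneg
        · intro b hb
          obtain ⟨a, ha, rfl⟩ := Finset.mem_image.1 hb
          exact hi a ha
        · intro b hb _
          exact hG b hb

/-- Poisson probabilities are `≤ 1/√(1+S)`. -/
lemma poisson_bound (S : ℝ) (hS : 0 ≤ S) (n : ℕ) :
    S ^ n / (n.factorial : ℝ) ≤ Real.exp S / Real.sqrt (1 + S) := by
  have key : ∀ d n : ℕ, S ≤ n + 1 + d →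
      S ^ n / (n.factorial : ℝ) ≤ Real.exp S / Real.sqrt (1 + S) := by
    intro d
    induction d with
    | zero =>
      intro n hn
      have hsq : 0 < Real.sqrt (1 + S) := Real.sqrt_pos.2 (by linarith)
      rcases Nat.eq_zero_or_pos n with rfl | hpos
      · rw [le_div_iff₀ hsq]
        have h1 : Real.sqrt (1 + S) ≤ 1 + S := by
          rw [Real.sqrt_le_left (by linarith)]
          nlinarith
        have h2 := Real.add_one_le_exp S
        simp
        linarith
      · have hn1 : (1 : ℝ) ≤ n := by exact_mod_cast hpos
        have hst := Stirling.le_factorial_stirling n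
        have hpow : S ^ n ≤ Real.exp S * ((n : ℝ) / Real.exp 1) ^ n := by
          have h1 : S / n ≤ Real.exp (S / n - 1) := by
            have := Real.add_one_le_exp (S / n - 1)
            linarith
          have h2 : (S / n) ^ n ≤ (Real.exp (S / n - 1)) ^ n :=
            pow_le_pow_left₀ (by positivity) h1 n
          rw [← Real.exp_nat_mul] at h2
          have h3 : (n : ℝ) * (S / n - 1) = S - n := by field_simp
          rw [h3, div_pow, div_le_iff₀ (by positivity)] at h2
          rw [div_pow, ← Real.exp_nat_mul, mul_one]
          calc S ^ n ≤ _ := h2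
            _ = _ := by rw [Real.exp_sub]; ring
        have hsq2 : Real.sqrt (1 + S) ≤ Real.sqrt (2 * Real.pi * n) := by
          apply Real.sqrt_le_sqrt
          simp only [Nat.cast_zero, add_zero] at hn
          nlinarith [Real.pi_gt_three]
        rw [div_le_div_iff₀ (by positivity) hsq]
        calc S ^ n * Real.sqrt (1 + S)
            ≤ (Real.exp S * ((n : ℝ) / Real.exp 1) ^ n) * Real.sqrt (2 * Real.pi * n) := by
              gcongr
          _ = Real.exp S * (Real.sqrt (2 * Real.pi * n) * ((n : ℝ) / Real.exp 1) ^ n) := by ring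
          _ ≤ _ := by gcongr
    | succ d ih =>
      intro n hn
      by_cases h : S ≤ n + 1
      · exact ih n (by push_cast at *; linarith [Nat.cast_nonneg (α := ℝ) d])
      · push Not at h
        refine le_trans ?_ (ih (n + 1) (by push_cast at *; linarith))
        rw [Nat.factorial_succ, pow_succ, div_le_div_iff₀ (by positivity) (by positivity)]
        push_cast
        have : 0 ≤ S ^ n * (n.factorial : ℝ) := by positivity
        nlinarith
  obtain ⟨d, hd⟩ := exists_nat_ge S
  exact key d n (by linarith [Nat.cast_nonneg (α := ℝ) n])

/-- Weighted LYM-type inequality for the family of subsets with prescribed positive sum. -/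
lemma lym_aux (P : Finset ℕ) (a f : ℕ → ℝ) (c : ℝ) (ha : ∀ p ∈ P, 0 ≤ a p)
    (hf : ∀ p ∈ P, 0 < f p) (hc : 0 ≤ c) (hcS : c * ∑ p ∈ P, a p ≤ 1) (N : ℕ) :
    ∀ k : ℝ, ∑ T ∈ P.powerset.filter (fun T => T.card ≤ N ∧ ∑ p ∈ T, f p = k),
      (T.card.factorial : ℝ) * (∏ p ∈ T, a p) * c ^ T.card ≤ 1 := by
  have hsub1 : ∀ s : Finset (Finset ℕ), s ⊆ {∅} → ∑ T ∈ s,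
      (T.card.factorial : ℝ) * (∏ p ∈ T, a p) * c ^ T.card ≤ 1 := by
    intro s hs
    calc _ ≤ ∑ T ∈ ({∅} : Finset (Finset ℕ)),
          (T.card.factorial : ℝ) * (∏ p ∈ T, a p) * c ^ T.card := by
          apply Finset.sum_le_sum_of_subset_of_nonneg hs
          intro i hi _
          rw [Finset.mem_singleton.1 hi]
          simp
      _ = 1 := by simp
  induction N with
  | zero =>
    intro k
    apply hsub1
    intro T hT
    simp only [Finset.mem_filter, Nat.le_zero, Finset.card_eq_zero] at hT
    simp [hT.2.1]
  | succ N ih =>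
    intro k
    by_cases hk : k = 0
    · apply hsub1
      intro T hT
      simp only [Finset.mem_filter, Finset.mem_powerset] at hT
      rw [Finset.mem_singleton]
      by_contra hne
      have : 0 < ∑ p ∈ T, f p :=
        Finset.sum_pos (fun p hp => hf p (hT.1 hp)) (Finset.nonempty_iff_ne_empty.2 hne)
      linarith [hT.2.2]
    · have hstep : ∀ T ∈ P.powerset.filter (fun T => T.card ≤ N + 1 ∧ ∑ p ∈ T, f p = k),
          (T.card.factorial : ℝ) * (∏ p ∈ T, a p) * c ^ T.card =
          ∑ p ∈ T, (c * a p) * (((T.erase p).card.factorial : ℝ) * (∏ q ∈ T.erase p, a q) *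
            c ^ (T.erase p).card) := by
        intro T hT
        simp only [Finset.mem_filter, Finset.mem_powerset] at hT
        have hne : T.Nonempty := by
          rw [Finset.nonempty_iff_ne_empty]
          rintro rfl
          simp at hT
          exact hk hT.symm
        have hcard : 0 < T.card := hne.card_pos
        obtain ⟨d, hd⟩ : ∃ d, T.card = d + 1 := ⟨T.card - 1, by omega⟩
        have : ∀ p ∈ T, (c * a p) * (((T.erase p).card.factorial : ℝ) *
            (∏ q ∈ T.erase p, a q) * c ^ (T.erase p).card) =
            (d.factorial : ℝ) * (∏ p ∈ T, a p) * c ^ (d + 1) := by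
          intro p hp
          rw [Finset.card_erase_of_mem hp, hd, Nat.add_sub_cancel, ← Finset.mul_prod_erase T a hp]
          ring
        rw [Finset.sum_congr rfl this, Finset.sum_const, hd, Nat.factorial_succ, nsmul_eq_mul]
        push_cast
        ring
      rw [Finset.sum_congr rfl hstep]
      rw [Finset.sum_sigma']
      calc _ ≤ ∑ x ∈ P.sigma (fun p => P.powerset.filter
              (fun T => T.card ≤ N ∧ ∑ q ∈ T, f q = k - f p)),
              (c * a x.1) * ((x.2.card.factorial : ℝ) * (∏ q ∈ x.2, a q) * c ^ x.2.card) := by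
            apply sum_le_sum_inj _ _ _ _ (fun x => ⟨x.2, x.1.erase x.2⟩)
            · rintro ⟨T, p⟩ h
              simp only [Finset.mem_sigma, Finset.mem_filter, Finset.mem_powerset] at h ⊢
              obtain ⟨⟨h1, h2, h3⟩, h4⟩ := h
              refine ⟨h1 h4, (Finset.erase_subset _ _).trans h1, ?_, ?_⟩
              · rw [Finset.card_erase_of_mem h4]; omega
              · rw [← h3, ← Finset.add_sum_erase T f h4]; ring
            · rintro ⟨T, p⟩ h ⟨T', p'⟩ h' heq
              simp only [Finset.mem_sigma] at h h'
              simp only [Sigma.mk.injEq, heq_eq_eq] at heq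
              obtain ⟨rfl, h2⟩ := heq
              have : T = T' := by
                rw [← Finset.insert_erase h.2, ← Finset.insert_erase h'.2, h2]
              subst this
              rfl
            · rintro ⟨T, p⟩ h
              exact le_rfl
            · rintro ⟨p, T⟩ h
              simp only [Finset.mem_sigma, Finset.mem_filter, Finset.mem_powerset] at h
              have h1 := ha p h.1
              have h2 : 0 ≤ ∏ q ∈ T, a q := Finset.prod_nonneg (fun q hq => ha q (h.2.1 hq))
              positivity
        _ = ∑ p ∈ P, (c * a p) * ∑ T ∈ P.powerset.filter
              (fun T => T.card ≤ N ∧ ∑ q ∈ T, f q = k - f p),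
              ((T.card.factorial : ℝ) * (∏ q ∈ T, a q) * c ^ T.card) := by
            rw [Finset.sum_sigma]
            simp_rw [Finset.mul_sum]
        _ ≤ ∑ p ∈ P, (c * a p) * 1 := by
            apply Finset.sum_le_sum
            intro p hp
            apply mul_le_mul_of_nonneg_left (ih _)
            exact mul_nonneg hc (ha p hp)
        _ ≤ 1 := by
            simp_rw [mul_one]
            rw [← Finset.mul_sum]
            exact hcS

/-- Erdős–Littlewood–Offord type inequality, positive steps. -/
lemma lo_pos (P : Finset ℕ) (a f : ℕ → ℝ) (ha : ∀ p ∈ P, 0 ≤ a p)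
    (hf : ∀ p ∈ P, 0 < f p) (k : ℝ) :
    ∑ T ∈ P.powerset.filter (fun T => ∑ p ∈ T, f p = k), ∏ p ∈ T, a p ≤
      Real.exp (∑ p ∈ P, a p) / Real.sqrt (1 + ∑ p ∈ P, a p) := by
  have hS : 0 ≤ ∑ p ∈ P, a p := Finset.sum_nonneg ha
  rcases hS.eq_or_lt with h0 | hpos
  · have hz : ∀ p ∈ P, a p = 0 := (Finset.sum_eq_zero_iff_of_nonneg ha).1 h0.symm
    calc _ ≤ ∑ T ∈ P.powerset, ∏ p ∈ T, a p := by
          apply Finset.sum_le_sum_of_subset_of_nonneg (Finset.filter_subset _ _)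
          intro T hT _
          exact Finset.prod_nonneg (fun q hq => ha q (Finset.mem_powerset.1 hT hq))
      _ = ∏ p ∈ P, (1 + a p) := by rw [Finset.prod_one_add]
      _ = 1 := Finset.prod_eq_one (fun p hp => by rw [hz p hp]; simp)
      _ ≤ _ := by rw [← h0]; simp
  · set S := ∑ p ∈ P, a p with hSdef
    have h := lym_aux P a f S⁻¹ ha hf (by positivity) (by rw [inv_mul_cancel₀ hpos.ne']) P.card k
    calc _ ≤ ∑ T ∈ P.powerset.filter (fun T => T.card ≤ P.card ∧ ∑ p ∈ T, f p = k),
          ((T.card.factorial : ℝ) * (∏ p ∈ T, a p) * S⁻¹ ^ T.card) *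
            (Real.exp S / Real.sqrt (1 + S)) := by
          have : P.powerset.filter (fun T => ∑ p ∈ T, f p = k) =
              P.powerset.filter (fun T => T.card ≤ P.card ∧ ∑ p ∈ T, f p = k) := by
            apply Finset.filter_congr
            intro T hT
            simp [Finset.card_le_card (Finset.mem_powerset.1 hT)]
          rw [this]
          apply Finset.sum_le_sum
          intro T hT
          simp only [Finset.mem_filter, Finset.mem_powerset] at hT
          have h2 : 0 ≤ ∏ q ∈ T, a q := Finset.prod_nonneg (fun q hq => ha q (hT.1 hq))
          have h3 := poisson_bound S hpos.le T.card
          calc ∏ p ∈ T, a p = ((T.card.factorial : ℝ) * (∏ p ∈ T, a p) * S⁻¹ ^ T.card) *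
                (S ^ T.card / (T.card.factorial : ℝ)) := by
                rw [inv_pow]
                field_simp
            _ ≤ _ := by gcongr
      _ ≤ 1 * (Real.exp S / Real.sqrt (1 + S)) := by
          rw [← Finset.sum_mul]
          gcongr
      _ = _ := one_mul _

lemma lo_neg (P : Finset ℕ) (a f : ℕ → ℝ) (ha : ∀ p ∈ P, 0 ≤ a p)
    (hf : ∀ p ∈ P, f p < 0) (k : ℝ) :
    ∑ T ∈ P.powerset.filter (fun T => ∑ p ∈ T, f p = k), ∏ p ∈ T, a p ≤
      Real.exp (∑ p ∈ P, a p) / Real.sqrt (1 + ∑ p ∈ P, a p) := by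
  have h := lo_pos P a (fun p => - f p) ha (fun p hp => by simpa using hf p hp) (-k)
  simpa [Finset.sum_neg_distrib, neg_inj] using h

/-- Euler product upper bound. -/
lemma euler_bound (g : ℕ → ℝ) (hg : ∀ n, 0 ≤ g n) (g1 : g 1 ≤ 1)
    (hmul : ∀ m n : ℕ, m ≠ 0 → n ≠ 0 → Nat.Coprime m n → g (m * n) = g m * g n) (M : ℕ)
    (P : Finset ℕ) : (∀ p ∈ P, p.Prime) →
    ∑ n ∈ (Finset.Icc 1 M).filter (fun n => ∀ q : ℕ, q.Prime → q ∣ n → q ∈ P), g n ≤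
      ∏ p ∈ P, ∑ ν ∈ Finset.range (M + 1), g (p ^ ν) := by
  induction P using Finset.induction_on with
  | empty =>
    intro _
    calc _ ≤ ∑ n ∈ ({1} : Finset ℕ), g n := by
          apply Finset.sum_le_sum_of_subset_of_nonneg
          · intro n hn
            simp only [Finset.mem_filter, Finset.mem_Icc] at hn
            rw [Finset.mem_singleton]
            by_contra hne
            obtain ⟨q, hq, hqn⟩ := Nat.exists_prime_and_dvd hne
            simpa using hn.2 q hq hqn
          · intro i _ _; exact hg i
      _ ≤ _ := by simpa using g1
  | insert p P hp ih =>
    intro hP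
    have hpp : p.Prime := hP p (Finset.mem_insert_self _ _)
    have ih' := ih (fun q hq => hP q (Finset.mem_insert_of_mem hq))
    rw [Finset.prod_insert hp]
    calc _ ≤ ∑ x ∈ (Finset.range (M + 1)) ×ˢ ((Finset.Icc 1 M).filter
            (fun n => ∀ q : ℕ, q.Prime → q ∣ n → q ∈ P)), g (p ^ x.1) * g x.2 := by
          apply sum_le_sum_inj _ _ _ _ (fun n => (n.factorization p, n / p ^ (n.factorization p)))
          · intro n hn
            simp only [Finset.mem_filter, Finset.mem_Icc, Finset.mem_product,
              Finset.mem_range] at hn ⊢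
            have hn0 : n ≠ 0 := by omega
            have h1 : 0 < n / p ^ (n.factorization p) := Nat.ordCompl_pos p hn0
            refine ⟨?_, ⟨h1, (Nat.div_le_self _ _).trans hn.1.2⟩, ?_⟩
            · have := Nat.factorization_lt p hn0
              omega
            · intro q hq hqn
              have := hn.2 q hq (hqn.trans (Nat.ordCompl_dvd n p))
              rcases Finset.mem_insert.1 this with rfl | h
              · exact absurd hqn (Nat.not_dvd_ordCompl hq hn0)
              · exact h
          · intro a ha b hb hab
            simp only [Prod.mk.injEq] at hab
            rw [← Nat.ordProj_mul_ordCompl_eq_self a p, ← Nat.ordProj_mul_ordCompl_eq_self b p,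
              hab.2, hab.1]
          · intro n hn
            simp only [Finset.mem_filter, Finset.mem_Icc] at hn
            have hn0 : n ≠ 0 := by omega
            have h1 : 0 < n / p ^ (n.factorization p) := Nat.ordCompl_pos p hn0
            have hco : Nat.Coprime (p ^ (n.factorization p)) (n / p ^ (n.factorization p)) :=
              Nat.Coprime.pow_left _ (Nat.coprime_ordCompl hpp hn0)
            rw [← hmul _ _ (pow_ne_zero _ hpp.ne_zero) h1.ne' hco,
              Nat.ordProj_mul_ordCompl_eq_self]
          · intro x _
            exact mul_nonneg (hg _) (hg _)
      _ = (∑ ν ∈ Finset.range (M + 1), g (p ^ ν)) * ∑ n ∈ (Finset.Icc 1 M).filter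
            (fun n => ∀ q : ℕ, q.Prime → q ∣ n → q ∈ P), g n := by
          rw [Finset.sum_product, Finset.sum_mul_sum]
      _ ≤ _ := by
          apply mul_le_mul_of_nonneg_left ih'
          exact Finset.sum_nonneg (fun _ _ => hg _)

/-- The `y`-friable integers up to `u`. -/
noncomputable def fri (y u : ℝ) : Finset ℕ :=
  (Finset.Icc 1 ⌊u⌋₊).filter (fun n => ∀ p : ℕ, p.Prime → p ∣ n → (p : ℝ) ≤ y)

lemma mem_primesBelow {x : ℝ} {p : ℕ} : p ∈ primesBelow x ↔ p.Prime ∧ (p : ℝ) ≤ x := by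
  unfold primesBelow
  simp only [Finset.mem_filter, Finset.mem_range, Nat.lt_succ_iff]
  constructor
  · rintro ⟨h1, h2⟩
    refine ⟨h2, ?_⟩
    by_contra h
    push Not at h
    rcases le_or_gt 0 x with hx | hx
    · have := (Nat.le_floor_iff hx).1 h1
      linarith
    · rw [Nat.floor_of_nonpos hx.le] at h1
      have := h2.pos
      omega
  · rintro ⟨h1, h2⟩
    exact ⟨Nat.le_floor h2, h1⟩

lemma mem_fri {y u : ℝ} {n : ℕ} : n ∈ fri y u ↔
    1 ≤ n ∧ (n : ℝ) ≤ u ∧ ∀ p : ℕ, p.Prime → p ∣ n → (p : ℝ) ≤ y := by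
  unfold fri
  simp only [Finset.mem_filter, Finset.mem_Icc]
  constructor
  · rintro ⟨⟨h1, h2⟩, h3⟩
    refine ⟨h1, ?_, h3⟩
    rw [Nat.le_floor_iff' (by omega)] at h2
    exact h2
  · rintro ⟨h1, h2, h3⟩
    exact ⟨⟨h1, Nat.le_floor h2⟩, h3⟩

lemma coprime_prime_prod (T : Finset ℕ) (p : ℕ) (hp : p.Prime) (hT : ∀ q ∈ T, q.Prime)
    (hpT : p ∉ T) : Nat.Coprime p (∏ q ∈ T, q) := by
  apply Nat.Coprime.prod_right
  intro q hq
  rw [Nat.coprime_primes hp (hT q hq)]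
  rintro rfl
  exact hpT hq

lemma mult_prod (r : ℕ → ℝ) (hr1 : r 1 = 1)
    (hrm : ∀ m n : ℕ, Nat.Coprime m n → r (m * n) = r m * r n) (T : Finset ℕ) :
    (∀ q ∈ T, q.Prime) → r (∏ q ∈ T, q) = ∏ q ∈ T, r q := by
  induction T using Finset.induction_on with
  | empty => intro _; simpa using hr1
  | insert p T hp ih =>
    intro h
    have hT : ∀ q ∈ T, q.Prime := fun q hq => h q (Finset.mem_insert_of_mem hq)
    rw [Finset.prod_insert hp, Finset.prod_insert hp, hrm _ _
      (coprime_prime_prod T p (h p (Finset.mem_insert_self _ _)) hT hp), ih hT]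

lemma add_prod (f : ℕ → ℝ)
    (hf : ∀ m n : ℕ, Nat.Coprime m n → f (m * n) = f m + f n) (T : Finset ℕ) :
    (∀ q ∈ T, q.Prime) → f (∏ q ∈ T, q) = ∑ q ∈ T, f q := by
  induction T using Finset.induction_on with
  | empty =>
    intro _
    have := hf 1 1 (by simp)
    simp at this ⊢
    linarith
  | insert p T hp ih =>
    intro h
    have hT : ∀ q ∈ T, q.Prime := fun q hq => h q (Finset.mem_insert_of_mem hq)
    rw [Finset.prod_insert hp, Finset.sum_insert hp, hf _ _
      (coprime_prime_prod T p (h p (Finset.mem_insert_self _ _)) hT hp), ih hT]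

lemma ac0 (y u : ℝ) (f r : ℕ → ℝ)
    (hf : ∀ m n : ℕ, Nat.Coprime m n → f (m * n) = f m + f n)
    (hr0 : ∀ n, 0 ≤ r n) (hr1 : r 1 = 1)
    (hrm : ∀ m n : ℕ, Nat.Coprime m n → r (m * n) = r m * r n)
    (Q : Finset ℕ) (hQ : Q ⊆ primesBelow y) (Lam : ℝ)
    (hLam : ∀ k : ℝ, ∑ T ∈ Q.powerset.filter (fun T => ∑ p ∈ T, f p = k),
      ∏ p ∈ T, (r p / p) ≤ Lam)
    (A : ℝ) (hA : ∀ N : ℕ, ∑ p ∈ primesBelow y, ∑ ν ∈ Finset.Icc 2 N,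
      r (p ^ ν) / (p : ℝ) ^ ν ≤ A) (k : ℝ) :
    ∑ m ∈ (fri y u).filter (fun m => f m = k), r m / m ≤
      Lam * Real.exp (∑ p ∈ primesBelow y \ Q, r p / p + A) := by
  have hQp : ∀ p ∈ Q, p.Prime := fun p hp => (mem_primesBelow.1 (hQ hp)).1
  set M := ⌊u⌋₊ with hM
  set g : ℕ → ℝ := fun n => if ∀ p ∈ Q, n.factorization p ≠ 1 then r n / n else 0 with hg
  have hg0 : ∀ n, 0 ≤ g n := by
    intro n
    simp only [hg]
    split_ifs
    · exact div_nonneg (hr0 n) (Nat.cast_nonneg n)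
    · exact le_rfl
  have hg1 : g 1 ≤ 1 := by simp [hg, hr1]
  have hgm : ∀ m n : ℕ, m ≠ 0 → n ≠ 0 → Nat.Coprime m n → g (m * n) = g m * g n := by
    intro m n hm hn hmn
    have hiff : (∀ p ∈ Q, (m * n).factorization p ≠ 1) ↔
        (∀ p ∈ Q, m.factorization p ≠ 1) ∧ (∀ p ∈ Q, n.factorization p ≠ 1) := by
      rw [← forall₂_and]
      apply forall₂_congr
      intro p hp
      have hpp := hQp p hp
      rw [Nat.factorization_mul hm hn, Finsupp.add_apply]
      have h0 : m.factorization p = 0 ∨ n.factorization p = 0 := by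
        by_contra hcon
        push Not at hcon
        have h1 := Nat.dvd_of_factorization_pos hcon.1
        have h2 := Nat.dvd_of_factorization_pos hcon.2
        exact Nat.not_coprime_of_dvd_of_dvd hpp.one_lt h1 h2 hmn
      omega
    simp only [hg]
    by_cases h1 : ∀ p ∈ Q, m.factorization p ≠ 1 <;>
    by_cases h2 : ∀ p ∈ Q, n.factorization p ≠ 1
    · rw [if_pos (hiff.2 ⟨h1, h2⟩), if_pos h1, if_pos h2, hrm m n hmn]
      push_cast
      rw [mul_div_mul_comm]
    · rw [if_neg (fun h => h2 (hiff.1 h).2), if_neg h2, mul_zero]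
    · rw [if_neg (fun h => h1 (hiff.1 h).1), if_neg h1, zero_mul]
    · rw [if_neg (fun h => h2 (hiff.1 h).2), if_neg h2, mul_zero]
  have hLam0 : 0 ≤ Lam := by
    refine le_trans ?_ (hLam 0)
    apply Finset.sum_nonneg
    intro T _
    exact Finset.prod_nonneg (fun p _ => div_nonneg (hr0 p) (Nat.cast_nonneg p))
  have hE := euler_bound g hg0 hg1 hgm M (primesBelow y)
    (fun p hp => (mem_primesBelow.1 hp).1)
  have hprod : ∏ p ∈ primesBelow y, ∑ ν ∈ Finset.range (M + 1), g (p ^ ν) ≤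
      Real.exp (∑ p ∈ primesBelow y \ Q, r p / p + A) := by
    have hterm : ∀ p ∈ primesBelow y, ∑ ν ∈ Finset.range (M + 1), g (p ^ ν) ≤
        Real.exp ((if p ∈ Q then 0 else r p / p) +
          ∑ ν ∈ Finset.Icc 2 (M + 1), r (p ^ ν) / (p : ℝ) ^ ν) := by
      intro p hp
      have hpp := (mem_primesBelow.1 hp).1
      refine le_trans ?_ (Real.add_one_le_exp _)
      calc ∑ ν ∈ Finset.range (M + 1), g (p ^ ν) ≤ ∑ ν ∈ Finset.range (M + 2), g (p ^ ν) := by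
            apply Finset.sum_le_sum_of_subset_of_nonneg
            · intro i; simp only [Finset.mem_range]; omega
            · intro i _ _; exact hg0 _
        _ = g (p ^ 0) + g (p ^ 1) + ∑ ν ∈ Finset.Ico 2 (M + 2), g (p ^ ν) := by
            rw [← Finset.sum_range_add_sum_Ico _ (show 2 ≤ M + 2 by omega)]
            simp [Finset.sum_range_succ]
        _ ≤ 1 + (if p ∈ Q then 0 else r p / p) +
              ∑ ν ∈ Finset.Icc 2 (M + 1), r (p ^ ν) / (p : ℝ) ^ ν := by
            refine add_le_add (add_le_add ?_ ?_) ?_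
            · simpa using hg1
            · rw [pow_one]
              by_cases hpQ : p ∈ Q
              · rw [if_pos hpQ]
                simp only [hg]
                rw [if_neg]
                intro h
                exact h p hpQ (Nat.Prime.factorization_self hpp)
              · rw [if_neg hpQ]
                simp only [hg]
                split_ifs
                · exact le_rfl
                · exact div_nonneg (hr0 p) (Nat.cast_nonneg p)
            · rw [show Finset.Icc 2 (M + 1) = Finset.Ico 2 (M + 2) by ext; simp; omega]
              apply Finset.sum_le_sum
              intro ν _
              simp only [hg]
              split_ifs
              · push_cast; exact le_rfl
              · exact div_nonneg (hr0 _) (by positivity)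
        _ = _ := by ring
    calc _ ≤ ∏ p ∈ primesBelow y, Real.exp ((if p ∈ Q then 0 else r p / p) +
          ∑ ν ∈ Finset.Icc 2 (M + 1), r (p ^ ν) / (p : ℝ) ^ ν) :=
          Finset.prod_le_prod (fun p _ => Finset.sum_nonneg (fun _ _ => hg0 _)) hterm
      _ = Real.exp (∑ p ∈ primesBelow y, (if p ∈ Q then 0 else r p / p) +
          ∑ p ∈ primesBelow y, ∑ ν ∈ Finset.Icc 2 (M + 1), r (p ^ ν) / (p : ℝ) ^ ν) := by
          rw [← Real.exp_sum, Finset.sum_add_distrib]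
      _ ≤ _ := by
          apply Real.exp_le_exp.2
          apply add_le_add _ (hA (M + 1))
          rw [Finset.sdiff_eq_filter, Finset.sum_filter]
          apply Finset.sum_le_sum
          intro p _
          by_cases h : p ∈ Q <;> simp [h]
  calc _ ≤ ∑ x ∈ ((Finset.Icc 1 M).filter (fun n => ∀ q : ℕ, q.Prime → q ∣ n →
            q ∈ primesBelow y)) ×ˢ Q.powerset, g x.1 *
            (if ∑ p ∈ x.2, f p = k - f x.1 then ∏ p ∈ x.2, (r p / p) else 0) := by
        apply sum_le_sum_inj _ _ _ _ (fun m => (m / ∏ p ∈ Q.filter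
          (fun p => m.factorization p = 1), p, Q.filter (fun p => m.factorization p = 1)))
        · intro m hm
          obtain ⟨hm1, hmk⟩ := Finset.mem_filter.1 hm
          obtain ⟨h1, h2, h3⟩ := mem_fri.1 hm1
          set T := Q.filter (fun p => m.factorization p = 1) with hT
          have hTd : ∏ p ∈ T, p ∣ m := by
            apply Finset.prod_primes_dvd
            · intro p hp
              exact (hQp p (Finset.mem_filter.1 hp).1).prime
            · intro p hp
              apply Nat.dvd_of_factorization_pos
              rw [(Finset.mem_filter.1 hp).2]
              exact one_ne_zero
          simp only [Finset.mem_product, Finset.mem_filter, Finset.mem_Icc, Finset.mem_powerset]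
          refine ⟨⟨⟨Nat.div_pos (Nat.le_of_dvd h1 hTd) (Nat.pos_of_dvd_of_pos hTd h1),
            (Nat.div_le_self _ _).trans (Nat.le_floor h2)⟩, ?_⟩, Finset.filter_subset _ _⟩
          intro q hq hqm
          exact mem_primesBelow.2 ⟨hq, h3 q hq (hqm.trans (Nat.div_dvd_of_dvd hTd))⟩
        · intro a ha b hb hab
          have hTd : ∀ m : ℕ, ∏ p ∈ Q.filter (fun p => m.factorization p = 1), p ∣ m := by
            intro m
            apply Finset.prod_primes_dvd
            · intro p hp
              exact (hQp p (Finset.mem_filter.1 hp).1).prime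
            · intro p hp
              apply Nat.dvd_of_factorization_pos
              rw [(Finset.mem_filter.1 hp).2]
              exact one_ne_zero
          simp only [Prod.mk.injEq] at hab
          rw [← Nat.div_mul_cancel (hTd a), ← Nat.div_mul_cancel (hTd b), hab.1, hab.2]
        · intro m hm
          obtain ⟨hm1, hmk⟩ := Finset.mem_filter.1 hm
          obtain ⟨h1, h2, h3⟩ := mem_fri.1 hm1
          set T := Q.filter (fun p => m.factorization p = 1) with hT
          have hTp : ∀ p ∈ T, p.Prime := fun p hp => hQp p (Finset.mem_filter.1 hp).1
          have hTd : ∏ p ∈ T, p ∣ m := by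
            apply Finset.prod_primes_dvd
            · intro p hp
              exact (hTp p hp).prime
            · intro p hp
              apply Nat.dvd_of_factorization_pos
              rw [(Finset.mem_filter.1 hp).2]
              exact one_ne_zero
          obtain ⟨q, hq⟩ := hTd
          have hm0 : m ≠ 0 := by omega
          have hPi0 : ∏ p ∈ T, p ≠ 0 := by
            intro h; rw [h] at hq; simp at hq; exact hm0 hq
          have hq0 : q ≠ 0 := by
            rintro rfl; simp at hq; exact hm0 hq
          have hdiv : m / ∏ p ∈ T, p = q := by
            rw [hq]; exact Nat.mul_div_cancel_left q (Nat.pos_of_ne_zero hPi0)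
          have hnd : ∀ p ∈ T, ¬ p ∣ q := by
            intro p hp hpq
            have h5 : p ^ 2 ∣ m := by
              rw [hq, pow_two]
              exact mul_dvd_mul (Finset.dvd_prod_of_mem _ hp) hpq
            have h6 := ((hTp p hp).pow_dvd_iff_le_factorization hm0).1 h5
            have := (Finset.mem_filter.1 hp).2
            omega
          have hco : Nat.Coprime (∏ p ∈ T, p) q := by
            apply Nat.Coprime.prod_left
            intro p hp
            exact ((hTp p hp).coprime_iff_not_dvd).2 (hnd p hp)
          have hgq : g q = r q / q := by
            simp only [hg]
            rw [if_pos]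
            intro p hp
            by_cases hpT : p ∈ T
            · rw [Nat.factorization_eq_zero_of_not_dvd (hnd p hpT)]
              exact zero_ne_one
            · have h5 : m.factorization p ≠ 1 := by
                intro h; exact hpT (Finset.mem_filter.2 ⟨hp, h⟩)
              rw [hq, Nat.factorization_mul hPi0 hq0, Finsupp.add_apply] at h5
              have h6 : (∏ p ∈ T, p).factorization p = 0 := by
                apply Nat.factorization_eq_zero_of_not_dvd
                rw [← (hQp p hp).coprime_iff_not_dvd]
                exact coprime_prime_prod T p (hQp p hp) hTp hpT
              omega
          have hfm : ∑ p ∈ T, f p = k - f q := by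
            rw [← add_prod f hf T hTp, ← hmk, hq, hf _ _ hco]; ring
          simp only
          rw [hdiv, hgq, if_pos hfm, Finset.prod_div_distrib, ← mult_prod r hr1 hrm T hTp]
          conv_lhs => rw [hq, hrm _ _ hco]
          push_cast
          rw [mul_div_mul_comm, mul_comm]
        · rintro ⟨q, T⟩ _
          apply mul_nonneg (hg0 _)
          simp only
          split_ifs
          · exact Finset.prod_nonneg (fun p _ => div_nonneg (hr0 p) (Nat.cast_nonneg p))
          · exact le_rfl
    _ = ∑ q ∈ (Finset.Icc 1 M).filter (fun n => ∀ q : ℕ, q.Prime → q ∣ n →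
            q ∈ primesBelow y), g q * ∑ T ∈ Q.powerset.filter
            (fun T => ∑ p ∈ T, f p = k - f q), ∏ p ∈ T, (r p / p) := by
        rw [Finset.sum_product]
        apply Finset.sum_congr rfl
        intro q _
        rw [Finset.sum_filter, Finset.mul_sum]
    _ ≤ ∑ q ∈ (Finset.Icc 1 M).filter (fun n => ∀ q : ℕ, q.Prime → q ∣ n →
            q ∈ primesBelow y), g q * Lam := by
        apply Finset.sum_le_sum
        intro q _
        exact mul_le_mul_of_nonneg_left (hLam _) (hg0 q)
    _ ≤ Lam * Real.exp (∑ p ∈ primesBelow y \ Q, r p / p + A) := by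
        rw [← Finset.sum_mul, mul_comm]
        exact mul_le_mul_of_nonneg_left (hE.trans hprod) hLam0

/-- Anticoncentration for logarithmic weights. -/
lemma ac (y u : ℝ) (f r : ℕ → ℝ)
    (hf : ∀ m n : ℕ, Nat.Coprime m n → f (m * n) = f m + f n)
    (hr0 : ∀ n, 0 ≤ r n) (hr1 : r 1 = 1)
    (hrm : ∀ m n : ℕ, Nat.Coprime m n → r (m * n) = r m * r n)
    (A : ℝ) (hA : ∀ N : ℕ, ∑ p ∈ primesBelow y, ∑ ν ∈ Finset.Icc 2 N,
      r (p ^ ν) / (p : ℝ) ^ ν ≤ A) (k : ℝ) :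
    ∑ m ∈ (fri y u).filter (fun m => f m = k), r m / m ≤
      2 * Real.exp A * Real.exp (∑ p ∈ primesBelow y, r p / p) / Real.sqrt (Ef f y r) := by
  have hnn : ∀ p : ℕ, 0 ≤ r p / p := fun p => div_nonneg (hr0 p) (Nat.cast_nonneg p)
  set Qp := (primesBelow y).filter (fun p => 0 < f p) with hQp
  set Qn := (primesBelow y).filter (fun p => f p < 0) with hQn
  have hsum : Ef f y r = 1 + (∑ p ∈ Qp, r p / p + ∑ p ∈ Qn, r p / p) := by
    unfold Ef
    rw [← Finset.sum_union]
    · congr 2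
      ext p
      simp only [hQp, hQn, Finset.mem_union, Finset.mem_filter, ← and_or_left]
      apply and_congr_right
      intro _
      rw [← lt_or_lt_iff_ne]; tauto
    · rw [Finset.disjoint_left]
      intro p h1 h2
      have := (Finset.mem_filter.1 h1).2
      have := (Finset.mem_filter.1 h2).2
      linarith
  have key : ∀ Q : Finset ℕ, Q ⊆ primesBelow y →
      (∀ k : ℝ, ∑ T ∈ Q.powerset.filter (fun T => ∑ p ∈ T, f p = k), ∏ p ∈ T, (r p / p) ≤
        Real.exp (∑ p ∈ Q, r p / p) / Real.sqrt (1 + ∑ p ∈ Q, r p / p)) →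
      Ef f y r ≤ 2 * (1 + ∑ p ∈ Q, r p / p) →
      ∑ m ∈ (fri y u).filter (fun m => f m = k), r m / m ≤
      2 * Real.exp A * Real.exp (∑ p ∈ primesBelow y, r p / p) / Real.sqrt (Ef f y r) := by
    intro Q hQ hLO hE
    refine (ac0 y u f r hf hr0 hr1 hrm Q hQ _ hLO A hA k).trans ?_
    have hQ0 : 0 ≤ ∑ p ∈ Q, r p / p := Finset.sum_nonneg (fun p _ => hnn p)
    have hE1 : 0 < Ef f y r := by
      unfold Ef
      have : 0 ≤ ∑ p ∈ (primesBelow y).filter (fun p => f p ≠ 0), r p / p :=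
        Finset.sum_nonneg (fun p _ => hnn p)
      linarith
    have hs1 : 0 < Real.sqrt (Ef f y r) := Real.sqrt_pos.2 hE1
    have hs2 : 0 < Real.sqrt (1 + ∑ p ∈ Q, r p / p) := Real.sqrt_pos.2 (by linarith)
    have hs3 : Real.sqrt (Ef f y r) ≤ 2 * Real.sqrt (1 + ∑ p ∈ Q, r p / p) := by
      rw [Real.sqrt_le_left (by positivity), mul_pow, Real.sq_sqrt (by linarith)]
      linarith
    have heq : Real.exp (∑ p ∈ primesBelow y, r p / p) =
        Real.exp (∑ p ∈ Q, r p / p) * Real.exp (∑ p ∈ primesBelow y \ Q, r p / p) := by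
      rw [← Real.exp_add, add_comm, Finset.sum_sdiff hQ]
    rw [heq, Real.exp_add, div_mul_eq_mul_div, div_le_div_iff₀ hs2 hs1]
    set X := Real.exp (∑ p ∈ Q, r p / p)
    set Y := Real.exp (∑ p ∈ primesBelow y \ Q, r p / p)
    calc X * (Y * Real.exp A) * Real.sqrt (Ef f y r) ≤
        X * (Y * Real.exp A) * (2 * Real.sqrt (1 + ∑ p ∈ Q, r p / p)) := by gcongr
      _ = _ := by ring
  rcases le_total (∑ p ∈ Qn, r p / p) (∑ p ∈ Qp, r p / p) with h | h
  · apply key Qp (Finset.filter_subset _ _)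
    · intro k
      exact lo_pos Qp (fun p => r p / p) f (fun p _ => hnn p)
        (fun p hp => (Finset.mem_filter.1 hp).2) k
    · rw [hsum]; linarith
  · apply key Qn (Finset.filter_subset _ _)
    · intro k
      exact lo_neg Qn (fun p => r p / p) f (fun p _ => hnn p)
        (fun p hp => (Finset.mem_filter.1 hp).2) k
    · rw [hsum]; linarith

/-- Chebyshev. -/
lemma cheb (r : ℕ → ℝ) (A y W : ℝ) (hA : 0 ≤ A)
    (hrA : ∀ p : ℕ, p.Prime → (p : ℝ) ≤ y → r p ≤ A) (hW : 0 ≤ W) (hWy : W ≤ y) :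
    ∑ p ∈ primesBelow W, r p * Real.log p ≤ A * Real.log 4 * W := by
  have h1 := Chebyshev.theta_le_log4_mul_x hW
  have h2 : Chebyshev.theta W = ∑ p ∈ primesBelow W, Real.log p := by
    rw [Chebyshev.theta_eq_sum_Icc]
    apply Finset.sum_congr _ (fun _ _ => rfl)
    unfold primesBelow
    ext p; simp
  calc _ ≤ ∑ p ∈ primesBelow W, A * Real.log p := by
        apply Finset.sum_le_sum
        intro p hp
        obtain ⟨hpp, hpW⟩ := mem_primesBelow.1 hp
        apply mul_le_mul_of_nonneg_right (hrA p hpp (hpW.trans hWy))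
        exact Real.log_nonneg (by exact_mod_cast hpp.one_lt.le)
    _ = A * Chebyshev.theta W := by rw [h2, Finset.mul_sum]
    _ ≤ A * (Real.log 4 * W) := by gcongr
    _ = _ := by ring

lemma logdec (y u : ℝ) (hu : 0 < u) (f r : ℕ → ℝ)
    (hf : ∀ m n : ℕ, Nat.Coprime m n → f (m * n) = f m + f n)
    (hr0 : ∀ n, 0 ≤ r n)
    (hrm : ∀ m n : ℕ, Nat.Coprime m n → r (m * n) = r m * r n)
    (A : ℝ) (hA : ∀ N : ℕ, ∑ p ∈ primesBelow y, ∑ ν ∈ Finset.Icc 2 N,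
      r (p ^ ν) * Real.log ((p : ℝ) ^ ν) / (p : ℝ) ^ ν ≤ A)
    (Lam : ℝ)
    (hLam : ∀ k : ℝ, ∑ m ∈ (fri y u).filter (fun m => f m = k), r m / m ≤ Lam) (k : ℝ) :
    (∑ n ∈ (fri y u).filter (fun n => f n = k), r n) * Real.log u ≤
      ∑ m ∈ fri y u, r m * ∑ p ∈ (primesBelow (min (u / m) y)).filter
        (fun p => f p + f m = k), r p * Real.log p + (A + 1) * u * Lam := by
  have hLam0 : 0 ≤ Lam := by
    refine le_trans ?_ (hLam 0)
    exact Finset.sum_nonneg (fun m _ => div_nonneg (hr0 m) (Nat.cast_nonneg m))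
  set D := (fri y u).filter (fun n => f n = k) with hD
  have hDmem : ∀ n ∈ D, (1 ≤ n ∧ (n : ℝ) ≤ u ∧ ∀ p : ℕ, p.Prime → p ∣ n → (p : ℝ) ≤ y) ∧
      f n = k := by
    intro n hn
    obtain ⟨h1, h2⟩ := Finset.mem_filter.1 hn
    exact ⟨mem_fri.1 h1, h2⟩
  -- facts on the decomposition n = p^ν m
  have hdecomp : ∀ n ∈ D, ∀ p ∈ n.primeFactors,
      p.Prime ∧ (p : ℝ) ≤ y ∧ 1 ≤ n.factorization p ∧
      n / p ^ n.factorization p ∈ fri y u ∧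
      p ^ n.factorization p * (n / p ^ n.factorization p) = n ∧
      r n = r (p ^ n.factorization p) * r (n / p ^ n.factorization p) ∧
      f n = f (p ^ n.factorization p) + f (n / p ^ n.factorization p) ∧
      n.factorization p < n := by
    intro n hn p hp
    obtain ⟨⟨h1, h2, h3⟩, hk⟩ := hDmem n hn
    have hn0 : n ≠ 0 := by omega
    have hpp := Nat.prime_of_mem_primeFactors hp
    have hpd := Nat.dvd_of_mem_primeFactors hp
    have hc : 0 < n / p ^ (n.factorization p) := Nat.ordCompl_pos p hn0
    have hco : Nat.Coprime (p ^ (n.factorization p)) (n / p ^ (n.factorization p)) :=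
      Nat.Coprime.pow_left _ (Nat.coprime_ordCompl hpp hn0)
    have heq := Nat.ordProj_mul_ordCompl_eq_self n p
    refine ⟨hpp, h3 p hpp hpd, (hpp.dvd_iff_one_le_factorization hn0).1 hpd, ?_, heq, ?_, ?_,
      Nat.factorization_lt p hn0⟩
    · rw [mem_fri]
      refine ⟨hc, le_trans (by exact_mod_cast Nat.div_le_self _ _) h2, ?_⟩
      intro q hq hqd
      exact h3 q hq (hqd.trans (Nat.ordCompl_dvd n p))
    · rw [← hrm _ _ hco, heq]
    · rw [← hf _ _ hco, heq]
  have hlog : ∀ n ∈ D, r n * Real.log n = ∑ p ∈ n.primeFactors,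
      r n * (n.factorization p * Real.log p) := by
    intro n _
    rw [Real.log_nat_eq_sum_factorization, Finsupp.sum, Nat.support_factorization, Finset.mul_sum]
  set Sg := D.sigma (fun n => n.primeFactors) with hSg
  have hpart1 : ∑ x ∈ Sg.filter (fun x => x.1.factorization x.2 = 1),
      r x.1 * (x.1.factorization x.2 * Real.log x.2) ≤
      ∑ m ∈ fri y u, r m * ∑ p ∈ (primesBelow (min (u / m) y)).filter
        (fun p => f p + f m = k), r p * Real.log p := by
    simp_rw [Finset.mul_sum]
    rw [Finset.sum_sigma']
    apply sum_le_sum_inj _ _ _ _ (fun x => ⟨x.1 / x.2 ^ x.1.factorization x.2, x.2⟩)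
    · rintro ⟨n, p⟩ hx
      simp only [hSg, Finset.mem_filter, Finset.mem_sigma] at hx ⊢
      obtain ⟨⟨hn, hp⟩, h1⟩ := hx
      obtain ⟨a1, a2, a3, a4, a5, a6, a7, a8⟩ := hdecomp n hn p hp
      rw [h1, pow_one] at *
      refine ⟨a4, mem_primesBelow.2 ⟨a1, le_min ?_ a2⟩, ?_⟩
      · have hpos : (0 : ℝ) < ((n / p : ℕ) : ℝ) := by
          have := (mem_fri.1 a4).1
          exact_mod_cast this
        rw [le_div_iff₀ hpos]
        calc (p : ℝ) * ((n / p : ℕ) : ℝ) = ((p * (n / p) : ℕ) : ℝ) := by push_cast; ring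
          _ ≤ u := by rw [a5]; exact (hDmem n hn).1.2.1
      · rw [← a7]; exact (hDmem n hn).2
    · rintro ⟨n, p⟩ hx ⟨n', p'⟩ hx' heq
      simp only [hSg, Finset.mem_filter, Finset.mem_sigma] at hx hx'
      simp only [Sigma.mk.injEq, heq_eq_eq] at heq
      obtain ⟨h1, rfl⟩ := heq
      have e1 := (hdecomp n hx.1.1 p hx.1.2).2.2.2.2.1
      have e2 := (hdecomp n' hx'.1.1 p hx'.1.2).2.2.2.2.1
      have : n = n' := by rw [← e1, ← e2, h1, hx.2, hx'.2]
      subst this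
      rfl
    · rintro ⟨n, p⟩ hx
      simp only [hSg, Finset.mem_filter, Finset.mem_sigma] at hx ⊢
      obtain ⟨⟨hn, hp⟩, h1⟩ := hx
      obtain ⟨a1, a2, a3, a4, a5, a6, a7, a8⟩ := hdecomp n hn p hp
      rw [a6, h1, pow_one]
      apply le_of_eq
      push_cast
      ring
    · rintro ⟨m, p⟩ hx
      simp only [Finset.mem_filter, Finset.mem_sigma] at hx
      have hpp := (mem_primesBelow.1 hx.2.1).1
      have : 0 ≤ Real.log p := Real.log_nonneg (by exact_mod_cast hpp.one_lt.le)
      exact mul_nonneg (hr0 _) (mul_nonneg (hr0 _) this)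
  set N := ⌊u⌋₊ with hN
  have hpart2 : ∑ x ∈ Sg.filter (fun x => ¬ x.1.factorization x.2 = 1),
      r x.1 * (x.1.factorization x.2 * Real.log x.2) ≤ A * u * Lam := by
    calc _ ≤ ∑ w ∈ (primesBelow y ×ˢ Finset.Icc 2 N).sigma
            (fun w => (fri y u).filter (fun m => f m = k - f (w.1 ^ w.2))),
            (r (w.1.1 ^ w.1.2) * Real.log ((w.1.1 : ℝ) ^ w.1.2) / (w.1.1 : ℝ) ^ w.1.2) * u *
              (r w.2 / w.2) := by
          apply sum_le_sum_inj _ _ _ _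
            (fun x => ⟨(x.2, x.1.factorization x.2), x.1 / x.2 ^ x.1.factorization x.2⟩)
          · rintro ⟨n, p⟩ hx
            simp only [hSg, Finset.mem_filter, Finset.mem_sigma, Finset.mem_product,
              Finset.mem_Icc] at hx ⊢
            obtain ⟨⟨hn, hp⟩, h1⟩ := hx
            obtain ⟨a1, a2, a3, a4, a5, a6, a7, a8⟩ := hdecomp n hn p hp
            have hnN : n ≤ N := Nat.le_floor (hDmem n hn).1.2.1
            refine ⟨⟨mem_primesBelow.2 ⟨a1, a2⟩, by omega, by omega⟩, a4, ?_⟩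
            rw [← (hDmem n hn).2, a7]; ring
          · rintro ⟨n, p⟩ hx ⟨n', p'⟩ hx' heq
            simp only [hSg, Finset.mem_filter, Finset.mem_sigma] at hx hx'
            simp only [Sigma.mk.injEq, heq_eq_eq, Prod.mk.injEq] at heq
            obtain ⟨⟨rfl, h2⟩, h1⟩ := heq
            have e1 := (hdecomp n hx.1.1 p hx.1.2).2.2.2.2.1
            have e2 := (hdecomp n' hx'.1.1 p hx'.1.2).2.2.2.2.1
            have : n = n' := by rw [← e1, ← e2, h1, h2]
            subst this
            rfl
          · rintro ⟨n, p⟩ hx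
            simp only [hSg, Finset.mem_filter, Finset.mem_sigma] at hx ⊢
            obtain ⟨⟨hn, hp⟩, h1⟩ := hx
            obtain ⟨a1, a2, a3, a4, a5, a6, a7, a8⟩ := hdecomp n hn p hp
            set ν := n.factorization p with hν
            set m := n / p ^ ν with hm
            have hm0 : (0 : ℝ) < m := by exact_mod_cast (mem_fri.1 a4).1
            have hp0 : (0 : ℝ) < (p : ℝ) ^ ν := by
              have : (0 : ℝ) < p := by exact_mod_cast a1.pos
              positivity
            have hle : (p : ℝ) ^ ν * m ≤ u := by
              have h5 : ((p ^ ν * m : ℕ) : ℝ) ≤ u := by rw [a5]; exact (hDmem n hn).1.2.1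
              push_cast at h5
              exact h5
            rw [a6, ← Real.log_pow]
            have hL : 0 ≤ Real.log ((p : ℝ) ^ ν) := by
              apply Real.log_nonneg
              apply one_le_pow₀
              exact_mod_cast a1.one_lt.le
            have h6 : 0 ≤ r (p ^ ν) * r m * Real.log ((p : ℝ) ^ ν) :=
              mul_nonneg (mul_nonneg (hr0 _) (hr0 _)) hL
            calc r (p ^ ν) * r m * Real.log ((p : ℝ) ^ ν) ≤
                r (p ^ ν) * r m * Real.log ((p : ℝ) ^ ν) * (u / ((p : ℝ) ^ ν * m)) := by
                  apply le_mul_of_one_le_right h6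
                  rw [le_div_iff₀ (by positivity)]
                  linarith
              _ = _ := by field_simp
          · rintro ⟨⟨p, ν⟩, m⟩ hx
            simp only [Finset.mem_filter, Finset.mem_sigma, Finset.mem_product] at hx
            have hpp := (mem_primesBelow.1 hx.1.1).1
            have hL : 0 ≤ Real.log ((p : ℝ) ^ ν) := by
              apply Real.log_nonneg
              apply one_le_pow₀
              exact_mod_cast hpp.one_lt.le
            have h1 := hr0 m
            have h2 := hr0 (p ^ ν)
            simp only
            positivity
      _ = ∑ w ∈ primesBelow y ×ˢ Finset.Icc 2 N,
            (r (w.1 ^ w.2) * Real.log ((w.1 : ℝ) ^ w.2) / (w.1 : ℝ) ^ w.2) * u *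
              ∑ m ∈ (fri y u).filter (fun m => f m = k - f (w.1 ^ w.2)), (r m / m) := by
          rw [Finset.sum_sigma]
          simp_rw [Finset.mul_sum]
      _ ≤ ∑ w ∈ primesBelow y ×ˢ Finset.Icc 2 N,
            (r (w.1 ^ w.2) * Real.log ((w.1 : ℝ) ^ w.2) / (w.1 : ℝ) ^ w.2) * u * Lam := by
          apply Finset.sum_le_sum
          rintro ⟨p, ν⟩ hw
          apply mul_le_mul_of_nonneg_left (hLam _)
          have hpp := (mem_primesBelow.1 (Finset.mem_product.1 hw).1).1
          have hL : 0 ≤ Real.log ((p : ℝ) ^ ν) := by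
            apply Real.log_nonneg
            apply one_le_pow₀
            exact_mod_cast hpp.one_lt.le
          have h2 := hr0 (p ^ ν)
          simp only
          positivity
      _ = (∑ p ∈ primesBelow y, ∑ ν ∈ Finset.Icc 2 N,
            r (p ^ ν) * Real.log ((p : ℝ) ^ ν) / (p : ℝ) ^ ν) * u * Lam := by
          rw [← Finset.sum_mul, ← Finset.sum_mul, Finset.sum_product]
      _ ≤ A * u * Lam := by
          have := hA N
          gcongr
  have hlogsum : ∑ n ∈ D, r n * Real.log n ≤
      ∑ m ∈ fri y u, r m * ∑ p ∈ (primesBelow (min (u / m) y)).filter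
        (fun p => f p + f m = k), r p * Real.log p + A * u * Lam := by
    rw [Finset.sum_congr rfl hlog, Finset.sum_sigma',
      ← Finset.sum_filter_add_sum_filter_not _ (fun x => x.1.factorization x.2 = 1)]
    exact add_le_add hpart1 hpart2
  calc (∑ n ∈ D, r n) * Real.log u ≤ ∑ n ∈ D, (r n * Real.log n + u * (r n / n)) := by
        rw [Finset.sum_mul]
        apply Finset.sum_le_sum
        intro n hn
        have hn1 : (1 : ℝ) ≤ n := by exact_mod_cast (hDmem n hn).1.1
        have h1 : Real.log u = Real.log n + Real.log (u / n) := by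
          rw [← Real.log_mul (by positivity) (by positivity)]
          congr 1; field_simp
        have h2 : Real.log (u / n) ≤ u / n := Real.log_le_self (by positivity)
        rw [h1, mul_add, show u * (r n / n) = r n * (u / n) by ring]
        have := mul_le_mul_of_nonneg_left h2 (hr0 n)
        linarith
    _ = ∑ n ∈ D, r n * Real.log n + u * ∑ n ∈ D, (r n / n) := by
        rw [Finset.sum_add_distrib, Finset.mul_sum]
    _ ≤ _ := by
        have h3 := mul_le_mul_of_nonneg_left (hLam k) hu.le
        linarith

lemma innerV (r f : ℕ → ℝ) (A y W t : ℝ) (hA : 0 ≤ A) (hr0 : ∀ n, 0 ≤ r n)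
    (hrA : ∀ p : ℕ, p.Prime → (p : ℝ) ≤ y → r p ≤ A) (hW : 0 ≤ W) (hWy : W ≤ y) (ht : 0 ≤ t)
    (V : Finset ℝ) (hV : ∀ p : ℕ, p.Prime → t < (p : ℝ) → (p : ℝ) ≤ W → f p ∈ V) (a k : ℝ) :
    ∑ p ∈ (primesBelow W).filter (fun p => f p + a = k), r p * Real.log p ≤
      A * Real.log 4 * t + (if k - a ∈ V then A * Real.log 4 * W else 0) := by
  have hB : 0 ≤ A * Real.log 4 := mul_nonneg hA (Real.log_nonneg (by norm_num))
  have hnn : ∀ p ∈ primesBelow W, 0 ≤ r p * Real.log p := by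
    intro p hp
    have hpp := (mem_primesBelow.1 hp).1
    exact mul_nonneg (hr0 p) (Real.log_nonneg (by exact_mod_cast hpp.one_lt.le))
  split_ifs with h
  · have h1 : ∑ p ∈ (primesBelow W).filter (fun p => f p + a = k), r p * Real.log p ≤
        ∑ p ∈ primesBelow W, r p * Real.log p :=
      Finset.sum_le_sum_of_subset_of_nonneg (Finset.filter_subset _ _)
        (fun p hp _ => hnn p hp)
    have h2 := cheb r A y W hA hrA hW hWy
    have h3 : 0 ≤ A * Real.log 4 * t := by positivity
    linarith
  · have h1 : ∑ p ∈ (primesBelow W).filter (fun p => f p + a = k), r p * Real.log p ≤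
        ∑ p ∈ primesBelow (min t W), r p * Real.log p := by
      apply Finset.sum_le_sum_of_subset_of_nonneg
      · intro p hp
        obtain ⟨hp1, hp2⟩ := Finset.mem_filter.1 hp
        obtain ⟨hpp, hpW⟩ := mem_primesBelow.1 hp1
        refine mem_primesBelow.2 ⟨hpp, le_min ?_ hpW⟩
        by_contra hcon
        push Not at hcon
        apply h
        have := hV p hpp hcon hpW
        rwa [show k - a = f p by linarith]
      · intro p hp _
        obtain ⟨hpp, hpW⟩ := mem_primesBelow.1 hp
        exact hnn p (mem_primesBelow.2 ⟨hpp, hpW.trans (min_le_right _ _)⟩)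
    have h2 := cheb r A y (min t W) hA hrA (le_min ht hW) ((min_le_right _ _).trans hWy)
    have h3 : A * Real.log 4 * min t W ≤ A * Real.log 4 * t :=
      mul_le_mul_of_nonneg_left (min_le_left _ _) hB
    linarith

/-- Trivial bound. -/
lemma triv (y u : ℝ) (hy : 0 ≤ y) (hu : 0 < u) (r : ℕ → ℝ)
    (hr0 : ∀ n, 0 ≤ r n)
    (hrm : ∀ m n : ℕ, Nat.Coprime m n → r (m * n) = r m * r n)
    (A : ℝ) (hA0 : 0 ≤ A) (hrA : ∀ p : ℕ, p.Prime → (p : ℝ) ≤ y → r p ≤ A)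
    (hA : ∀ N : ℕ, ∑ p ∈ primesBelow y, ∑ ν ∈ Finset.Icc 2 N,
      r (p ^ ν) * Real.log ((p : ℝ) ^ ν) / (p : ℝ) ^ ν ≤ A)
    (T : ℝ) (hT : ∑ m ∈ fri y u, r m / m ≤ T) :
    (∑ n ∈ fri y u, r n) * Real.log u ≤ (A * Real.log 4 + A + 1) * u * T := by
  have hT0 : 0 ≤ T := le_trans
    (Finset.sum_nonneg (fun m _ => div_nonneg (hr0 m) (Nat.cast_nonneg m))) hT
  have h := logdec y u hu (fun _ => 0) r (by simp) hr0 hrm A hA T (by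
    intro k
    refine le_trans (Finset.sum_le_sum_of_subset_of_nonneg (Finset.filter_subset _ _) ?_) hT
    intro m _ _
    exact div_nonneg (hr0 m) (Nat.cast_nonneg m)) 0
  simp only [add_zero, Finset.filter_true] at h
  refine h.trans ?_
  have h2 : ∑ m ∈ fri y u, r m * ∑ p ∈ primesBelow (min (u / m) y), r p * Real.log p ≤
      A * Real.log 4 * u * T := by
    calc _ ≤ ∑ m ∈ fri y u, A * Real.log 4 * u * (r m / m) := by
          apply Finset.sum_le_sum
          intro m hm
          have hm1 : (0 : ℝ) < m := by exact_mod_cast (mem_fri.1 hm).1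
          have h3 := cheb r A y (min (u / m) y) hA0 hrA (le_min (by positivity) hy)
            (min_le_right _ _)
          have h4 : A * Real.log 4 * min (u / m) y ≤ A * Real.log 4 * (u / m) := by
            apply mul_le_mul_of_nonneg_left (min_le_left _ _)
            exact mul_nonneg hA0 (Real.log_nonneg (by norm_num))
          have h5 := mul_le_mul_of_nonneg_left (h3.trans h4) (hr0 m)
          refine h5.trans (le_of_eq ?_)
          ring
      _ = A * Real.log 4 * u * ∑ m ∈ fri y u, r m / m := by rw [Finset.mul_sum]
      _ ≤ _ := by
          apply mul_le_mul_of_nonneg_left hT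
          exact mul_nonneg (mul_nonneg hA0 (Real.log_nonneg (by norm_num))) hu.le
  linarith

lemma valset (f : ℕ → ℝ) (A t : ℝ)
    (h : (({v : ℝ | ∃ p : ℕ, p.Prime ∧ t < (p : ℝ) ∧ (p : ℝ) ≤ t ^ (Real.exp 1) ∧
            f p = v}).ncard : ℝ) ≤ A) :
    ∃ V : Finset ℝ, (V.card : ℝ) ≤ A ∧
      ∀ p : ℕ, p.Prime → t < (p : ℝ) → (p : ℝ) ≤ t ^ (Real.exp 1) → f p ∈ V := by
  have hfin : ({v : ℝ | ∃ p : ℕ, p.Prime ∧ t < (p : ℝ) ∧ (p : ℝ) ≤ t ^ (Real.exp 1) ∧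
            f p = v}).Finite := by
    apply Set.Finite.subset ((primesBelow (t ^ (Real.exp 1))).image f).finite_toSet
    rintro v ⟨p, hp, _, hp2, rfl⟩
    simp only [Finset.coe_image, Set.mem_image, Finset.mem_coe]
    exact ⟨p, mem_primesBelow.2 ⟨hp, hp2⟩, rfl⟩
  refine ⟨hfin.toFinset, ?_, ?_⟩
  · rwa [← Set.ncard_eq_toFinset_card _ hfin]
  · intro p hp h1 h2
    rw [Set.Finite.mem_toFinset]
    exact ⟨p, hp, h1, h2, rfl⟩

lemma valset_iter (f : ℕ → ℝ) (A zl yl L : ℝ) (hzl : 0 ≤ zl) (hL : L ≤ yl)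
    (h : ∀ s : ℝ, zl ≤ s → s ≤ yl → ∃ V : Finset ℝ, (V.card : ℝ) ≤ A ∧
      ∀ p : ℕ, p.Prime → Real.exp s < (p : ℝ) → (p : ℝ) ≤ Real.exp (Real.exp 1 * s) → f p ∈ V)
    (I : ℕ) : zl ≤ Real.exp (-(I : ℝ)) * L →
    ∃ V : Finset ℝ, (V.card : ℝ) ≤ I * A ∧
      ∀ p : ℕ, p.Prime → Real.exp (Real.exp (-(I : ℝ)) * L) < (p : ℝ) →
        (p : ℝ) ≤ Real.exp L → f p ∈ V := by
  induction I with
  | zero =>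
    intro _
    refine ⟨∅, by simp, ?_⟩
    intro p _ h1 h2
    simp at h1
    linarith
  | succ I ih =>
    intro hI
    have hL0 : 0 ≤ L := by
      have : 0 ≤ Real.exp (-((I + 1 : ℕ) : ℝ)) * L := hzl.trans hI
      exact nonneg_of_mul_nonneg_right this (Real.exp_pos _)
    have he : Real.exp 1 * (Real.exp (-((I + 1 : ℕ) : ℝ)) * L) = Real.exp (-(I : ℝ)) * L := by
      rw [← mul_assoc, ← Real.exp_add]
      congr 2
      push_cast; ring
    have hle : Real.exp (-((I + 1 : ℕ) : ℝ)) * L ≤ Real.exp (-(I : ℝ)) * L := by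
      apply mul_le_mul_of_nonneg_right _ hL0
      apply Real.exp_le_exp.2
      push_cast; linarith
    have hle2 : Real.exp (-((I + 1 : ℕ) : ℝ)) * L ≤ yl := by
      refine le_trans ?_ hL
      apply mul_le_of_le_one_left hL0
      rw [Real.exp_le_one_iff]
      have : (0 : ℝ) ≤ ((I + 1 : ℕ) : ℝ) := Nat.cast_nonneg _
      linarith
    obtain ⟨V1, hV1, hV1'⟩ := ih (hI.trans hle)
    obtain ⟨V2, hV2, hV2'⟩ := h _ hI hle2
    rw [he] at hV2'
    refine ⟨V1 ∪ V2, ?_, ?_⟩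
    · have : ((V1 ∪ V2).card : ℝ) ≤ V1.card + V2.card := by
        exact_mod_cast Finset.card_union_le V1 V2
      push_cast
      linarith
    · intro p hp h1 h2
      rw [Finset.mem_union]
      by_cases hc : (p : ℝ) ≤ Real.exp (Real.exp (-(I : ℝ)) * L)
      · exact Or.inr (hV2' p hp h1 hc)
      · exact Or.inl (hV1' p hp (not_le.1 hc) h2)

lemma sum_mem_V (D : Finset ℕ) (f g : ℕ → ℝ) (V : Finset ℝ) (k K : ℝ)
    (hK : ∀ k' : ℝ, ∑ m ∈ D.filter (fun m => f m = k'), g m ≤ K) :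
    ∑ m ∈ D, (if k - f m ∈ V then g m else 0) ≤ V.card * K := by
  calc ∑ m ∈ D, (if k - f m ∈ V then g m else 0)
      = ∑ m ∈ D, ∑ v ∈ V, (if f m = k - v then g m else 0) := by
        apply Finset.sum_congr rfl
        intro m _
        have : ∀ v ∈ V, (if f m = k - v then g m else 0) = (if k - f m = v then g m else 0) := by
          intro v _
          have : f m = k - v ↔ k - f m = v := by constructor <;> intro h <;> linarith
          simp only [this]
        rw [Finset.sum_congr rfl this, Finset.sum_ite_eq]
    _ = ∑ v ∈ V, ∑ m ∈ D.filter (fun m => f m = k - v), g m := by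
        rw [Finset.sum_comm]
        apply Finset.sum_congr rfl
        intro v _
        rw [Finset.sum_filter]
    _ ≤ ∑ v ∈ V, K := Finset.sum_le_sum (fun v _ => hK _)
    _ = _ := by rw [Finset.sum_const, nsmul_eq_mul]

lemma partA (y u : ℝ) (hy : 0 ≤ y) (hu : 0 < u) (f r : ℕ → ℝ) (hr0 : ∀ n, 0 ≤ r n)
    (A : ℝ) (hA0 : 0 ≤ A) (hrA : ∀ p : ℕ, p.Prime → (p : ℝ) ≤ y → r p ≤ A)
    (T Lam : ℝ) (hT : ∑ m ∈ fri y u, r m / m ≤ T)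
    (hLam : ∀ k : ℝ, ∑ m ∈ (fri y u).filter (fun m => f m = k), r m / m ≤ Lam)
    (t tau w : ℝ) (ht : 0 ≤ t) (htau : 0 ≤ tau) (htw : t ≤ tau * w) (V : Finset ℝ)
    (hV : ∀ p : ℕ, p.Prime → t < (p : ℝ) → (p : ℝ) ≤ min u y → f p ∈ V) (k : ℝ) :
    ∑ m ∈ (fri y u).filter (fun m : ℕ => w ≤ u / m), r m *
        ∑ p ∈ (primesBelow (min (u / m) y)).filter (fun p => f p + f m = k), r p * Real.log p ≤
      A * Real.log 4 * tau * u * T + A * Real.log 4 * u * (V.card * Lam) := by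
  have hB : 0 ≤ A * Real.log 4 := mul_nonneg hA0 (Real.log_nonneg (by norm_num))
  have hnn : ∀ m : ℕ, 0 ≤ r m / m := fun m => div_nonneg (hr0 m) (Nat.cast_nonneg m)
  calc _ ≤ ∑ m ∈ (fri y u).filter (fun m : ℕ => w ≤ u / m),
          (A * Real.log 4 * tau * u * (r m / m) +
            A * Real.log 4 * u * (if k - f m ∈ V then r m / m else 0)) := by
        apply Finset.sum_le_sum
        intro m hm
        obtain ⟨hm1, hm2⟩ := Finset.mem_filter.1 hm
        have hmp : (1 : ℝ) ≤ m := by exact_mod_cast (mem_fri.1 hm1).1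
        have hum : u / m ≤ u := div_le_self hu.le hmp
        have h1 := innerV r f A y (min (u / m) y) t hA0 hr0 hrA (le_min (by positivity) hy)
          (min_le_right _ _) ht V
          (fun p hp h1 h2 => hV p hp h1 (h2.trans (min_le_min hum le_rfl))) (f m) k
        have h2 : A * Real.log 4 * t ≤ A * Real.log 4 * (tau * (u / m)) := by
          apply mul_le_mul_of_nonneg_left _ hB
          exact htw.trans (mul_le_mul_of_nonneg_left hm2 htau)
        have h3 : (if k - f m ∈ V then A * Real.log 4 * min (u / m) y else 0) ≤
            A * Real.log 4 * (u / m) * (if k - f m ∈ V then 1 else 0) := by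
          split_ifs
          · rw [mul_one]
            exact mul_le_mul_of_nonneg_left (min_le_left _ _) hB
          · simp
        have h4 := mul_le_mul_of_nonneg_left (h1.trans (add_le_add h2 h3)) (hr0 m)
        refine h4.trans (le_of_eq ?_)
        split_ifs
        · ring
        · ring
    _ ≤ ∑ m ∈ fri y u, (A * Real.log 4 * tau * u * (r m / m) +
            A * Real.log 4 * u * (if k - f m ∈ V then r m / m else 0)) := by
        apply Finset.sum_le_sum_of_subset_of_nonneg (Finset.filter_subset _ _)
        intro m _ _
        have := hnn m
        split_ifs <;> positivity
    _ = A * Real.log 4 * tau * u * ∑ m ∈ fri y u, (r m / m) + A * Real.log 4 * u *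
          ∑ m ∈ fri y u, (if k - f m ∈ V then r m / m else 0) := by
        rw [Finset.sum_add_distrib, Finset.mul_sum, Finset.mul_sum]
    _ ≤ _ := by
        have := sum_mem_V (fri y u) f (fun m => r m / m) V k Lam hLam
        apply add_le_add
        · exact mul_le_mul_of_nonneg_left hT (by positivity)
        · exact mul_le_mul_of_nonneg_left this (by positivity)

/-- Facts about the exponential block of an `m ≤ u`. -/
lemma block_facts (y u : ℝ) (hu : 0 < u) (m : ℕ) (hm : m ∈ fri y u) :
    Real.exp (⌊Real.log (u / m)⌋₊ : ℝ) ≤ u / m ∧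
    u / m < Real.exp ((⌊Real.log (u / m)⌋₊ : ℝ) + 1) ∧
    m ∈ fri y (u / Real.exp (⌊Real.log (u / m)⌋₊ : ℝ)) := by
  obtain ⟨h1, h2, h3⟩ := mem_fri.1 hm
  have hm0 : (0 : ℝ) < m := by exact_mod_cast h1
  have hum : 1 ≤ u / m := by rw [le_div_iff₀ hm0]; linarith
  have hpos : 0 < u / m := by linarith
  have hlog : 0 ≤ Real.log (u / m) := Real.log_nonneg hum
  have e1 : Real.exp (⌊Real.log (u / m)⌋₊ : ℝ) ≤ u / m := by
    rw [← Real.le_log_iff_exp_le hpos]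
    exact Nat.floor_le hlog
  have e2 : u / m < Real.exp ((⌊Real.log (u / m)⌋₊ : ℝ) + 1) := by
    rw [← Real.log_lt_iff_lt_exp hpos]
    exact Nat.lt_floor_add_one _
  refine ⟨e1, e2, mem_fri.2 ⟨h1, ?_, h3⟩⟩
  rw [le_div_iff₀ hm0] at e1
  rw [le_div_iff₀ (Real.exp_pos _)]
  linarith

lemma partC (y u : ℝ) (hy : 0 ≤ y) (hu : 0 < u) (f r : ℕ → ℝ) (hr0 : ∀ n, 0 ≤ r n)
    (A : ℝ) (hA0 : 0 ≤ A) (hrA : ∀ p : ℕ, p.Prime → (p : ℝ) ≤ y → r p ≤ A)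
    (wl Kc : ℝ) (hwl : 0 ≤ wl) (hKc0 : 0 ≤ Kc)
    (hKc : ∀ j : ℕ, (j : ℝ) ≤ wl → ∑ m ∈ fri y (u / Real.exp j), r m ≤ Kc * (u / Real.exp j))
    (k : ℝ) :
    ∑ m ∈ (fri y u).filter (fun m : ℕ => u / m < Real.exp wl), r m *
        ∑ p ∈ (primesBelow (min (u / m) y)).filter (fun p => f p + f m = k), r p * Real.log p ≤
      A * Real.log 4 * (wl + 1) * Real.exp 1 * Kc * u := by
  have hB : 0 ≤ A * Real.log 4 := mul_nonneg hA0 (Real.log_nonneg (by norm_num))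
  calc _ ≤ ∑ m ∈ (fri y u).filter (fun m : ℕ => u / m < Real.exp wl),
          A * Real.log 4 * (r m * (u / m)) := by
        apply Finset.sum_le_sum
        intro m hm
        have hmp : (1 : ℝ) ≤ m := by exact_mod_cast (mem_fri.1 (Finset.mem_filter.1 hm).1).1
        have h0 : ∑ p ∈ (primesBelow (min (u / m) y)).filter (fun p => f p + f m = k),
            r p * Real.log p ≤ ∑ p ∈ primesBelow (min (u / m) y), r p * Real.log p := by
          apply Finset.sum_le_sum_of_subset_of_nonneg (Finset.filter_subset _ _)
          intro p hp _
          have hpp := (mem_primesBelow.1 hp).1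
          exact mul_nonneg (hr0 p) (Real.log_nonneg (by exact_mod_cast hpp.one_lt.le))
        have h1 := cheb r A y (min (u / m) y) hA0 hrA (le_min (by positivity) hy)
          (min_le_right _ _)
        have h2 : A * Real.log 4 * min (u / m) y ≤ A * Real.log 4 * (u / m) :=
          mul_le_mul_of_nonneg_left (min_le_left _ _) hB
        have h4 := mul_le_mul_of_nonneg_left (h0.trans (h1.trans h2)) (hr0 m)
        refine h4.trans (le_of_eq (by ring))
    _ = ∑ j ∈ Finset.range (⌊wl⌋₊ + 1),
          ∑ m ∈ ((fri y u).filter (fun m : ℕ => u / m < Real.exp wl)).filter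
            (fun m : ℕ => ⌊Real.log (u / m)⌋₊ = j), A * Real.log 4 * (r m * (u / m)) := by
        rw [Finset.sum_fiberwise_of_maps_to]
        intro m hm
        obtain ⟨hm1, hm2⟩ := Finset.mem_filter.1 hm
        have hm0 : (0 : ℝ) < m := by exact_mod_cast (mem_fri.1 hm1).1
        rw [Finset.mem_range, Nat.lt_succ_iff]
        apply Nat.floor_le_floor
        rw [Real.log_le_iff_le_exp (by positivity)]
        exact hm2.le
    _ ≤ ∑ j ∈ Finset.range (⌊wl⌋₊ + 1), A * Real.log 4 * Real.exp 1 * Kc * u := by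
        apply Finset.sum_le_sum
        intro j hj
        have hjw : (j : ℝ) ≤ wl := by
          have : j ≤ ⌊wl⌋₊ := by simpa [Nat.lt_succ_iff] using hj
          exact (Nat.le_floor_iff hwl).1 this
        calc _ ≤ ∑ m ∈ fri y (u / Real.exp j), A * Real.log 4 * (r m * Real.exp (j + 1)) := by
              refine sum_le_sum_inj _ _ _ _ (fun m => m) ?_ ?_ ?_ ?_
              · intro m hm
                obtain ⟨hm1, hm2⟩ := Finset.mem_filter.1 hm
                have := (block_facts y u hu m (Finset.mem_filter.1 hm1).1).2.2
                rwa [hm2] at this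
              · intro a _ b _ h; exact h
              · intro m hm
                obtain ⟨hm1, hm2⟩ := Finset.mem_filter.1 hm
                have := (block_facts y u hu m (Finset.mem_filter.1 hm1).1).2.1
                rw [hm2] at this
                have h5 := hr0 m
                have h6 := this.le
                gcongr
              · intro m _
                have h5 := hr0 m
                positivity
          _ = A * Real.log 4 * Real.exp (j + 1) * ∑ m ∈ fri y (u / Real.exp j), r m := by
              rw [Finset.mul_sum]
              apply Finset.sum_congr rfl
              intro m _; ring
          _ ≤ A * Real.log 4 * Real.exp (j + 1) * (Kc * (u / Real.exp j)) := by
              apply mul_le_mul_of_nonneg_left (hKc j hjw)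
              positivity
          _ = _ := by
              rw [Real.exp_add]
              field_simp
    _ = (⌊wl⌋₊ + 1) * (A * Real.log 4 * Real.exp 1 * Kc * u) := by
        rw [Finset.sum_const, Finset.card_range, nsmul_eq_mul]; push_cast; ring
    _ ≤ (wl + 1) * (A * Real.log 4 * Real.exp 1 * Kc * u) := by
        have := Nat.floor_le hwl
        gcongr
    _ = _ := by ring

lemma partB (y u : ℝ) (hy : 0 ≤ y) (hu : 0 < u) (f r : ℕ → ℝ) (hr0 : ∀ n, 0 ≤ r n)
    (A : ℝ) (hA0 : 0 ≤ A) (hrA : ∀ p : ℕ, p.Prime → (p : ℝ) ≤ y → r p ≤ A)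
    (T : ℝ) (hT : ∑ m ∈ fri y u, r m / m ≤ T)
    (w1 w2 Ki tau : ℝ) (hw1 : 1 ≤ w1) (hw2 : 0 ≤ w2) (hKi0 : 0 ≤ Ki) (htau0 : 0 ≤ tau)
    (hV : ∀ j : ℕ, (j : ℝ) ≤ w2 → w1 < j + 1 → ∃ V : Finset ℝ, (V.card : ℝ) ≤ A ∧
      ∀ p : ℕ, p.Prime → Real.exp ((j + 1) / Real.exp 1) < (p : ℝ) →
        (p : ℝ) ≤ Real.exp (j + 1) → f p ∈ V)
    (htau : ∀ j : ℕ, w1 < j + 1 → Real.exp ((j + 1) / Real.exp 1) ≤ tau * Real.exp j)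
    (hKi : ∀ j : ℕ, 1 ≤ j → (j : ℝ) ≤ w2 → ∀ k' : ℝ,
      ∑ m ∈ (fri y (u / Real.exp j)).filter (fun m => f m = k'), r m ≤ Ki * (u / Real.exp j))
    (k : ℝ) :
    ∑ m ∈ (fri y u).filter (fun m : ℕ => Real.exp w1 ≤ u / m ∧ u / m < Real.exp w2), r m *
        ∑ p ∈ (primesBelow (min (u / m) y)).filter (fun p => f p + f m = k), r p * Real.log p ≤
      A * Real.log 4 * tau * u * T + w2 * (A * Real.log 4 * Real.exp 1 * A * Ki * u) := by
  have hB : 0 ≤ A * Real.log 4 := mul_nonneg hA0 (Real.log_nonneg (by norm_num))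
  have hnn : ∀ m : ℕ, 0 ≤ r m / m := fun m => div_nonneg (hr0 m) (Nat.cast_nonneg m)
  set D := (fri y u).filter (fun m : ℕ => Real.exp w1 ≤ u / m ∧ u / m < Real.exp w2) with hD
  have hjf : ∀ m ∈ D, m ∈ fri y u ∧ (⌊Real.log (u / m)⌋₊ : ℝ) ≤ w2 ∧
      w1 < (⌊Real.log (u / m)⌋₊ : ℝ) + 1 ∧ 1 ≤ ⌊Real.log (u / m)⌋₊ := by
    intro m hm
    obtain ⟨hm1, hm2, hm3⟩ := Finset.mem_filter.1 hm
    have hm0 : (0 : ℝ) < m := by exact_mod_cast (mem_fri.1 hm1).1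
    have hpos : 0 < u / m := by positivity
    have h1 : w1 ≤ Real.log (u / m) := (Real.le_log_iff_exp_le hpos).2 hm2
    have h2 : Real.log (u / m) < w2 := (Real.log_lt_iff_lt_exp hpos).2 hm3
    refine ⟨hm1, ?_, ?_, ?_⟩
    · have := Nat.floor_le (show 0 ≤ Real.log (u / m) by linarith)
      linarith
    · have := Nat.lt_floor_add_one (Real.log (u / m))
      linarith
    · apply Nat.le_floor
      push_cast
      linarith
  choose! V hV1 hV2 using hV
  -- pointwise bound
  have hpt : ∀ m ∈ D, r m *
        ∑ p ∈ (primesBelow (min (u / m) y)).filter (fun p => f p + f m = k), r p * Real.log p ≤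
      A * Real.log 4 * tau * u * (r m / m) + A * Real.log 4 *
        Real.exp ((⌊Real.log (u / m)⌋₊ : ℝ) + 1) *
        (if k - f m ∈ V ⌊Real.log (u / m)⌋₊ then r m else 0) := by
    intro m hm
    obtain ⟨hm1, hm2, hm3, hm4⟩ := hjf m hm
    obtain ⟨e1, e2, e3⟩ := block_facts y u hu m hm1
    set j := ⌊Real.log (u / m)⌋₊ with hj
    have hmp : (1 : ℝ) ≤ m := by exact_mod_cast (mem_fri.1 hm1).1
    have h1 := innerV r f A y (min (u / m) y) (Real.exp ((j + 1) / Real.exp 1)) hA0 hr0 hrA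
      (le_min (by positivity) hy) (min_le_right _ _) (Real.exp_pos _).le (V j)
      (fun p hp h1 h2 => hV2 j hm2 hm3 p hp h1
        ((h2.trans (min_le_left _ _)).trans e2.le)) (f m) k
    have h2 : A * Real.log 4 * Real.exp ((j + 1) / Real.exp 1) ≤
        A * Real.log 4 * (tau * (u / m)) := by
      apply mul_le_mul_of_nonneg_left _ hB
      exact (htau j hm3).trans (mul_le_mul_of_nonneg_left e1 htau0)
    have h3 : (if k - f m ∈ V j then A * Real.log 4 * min (u / m) y else 0) ≤
        A * Real.log 4 * Real.exp (j + 1) * (if k - f m ∈ V j then 1 else 0) := by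
      split_ifs
      · rw [mul_one]
        exact mul_le_mul_of_nonneg_left ((min_le_left _ _).trans e2.le) hB
      · simp
    have h4 := mul_le_mul_of_nonneg_left (h1.trans (add_le_add h2 h3)) (hr0 m)
    refine h4.trans (le_of_eq ?_)
    split_ifs
    · ring
    · ring
  have hfib : ∑ m ∈ D, A * Real.log 4 * Real.exp ((⌊Real.log (u / m)⌋₊ : ℝ) + 1) *
        (if k - f m ∈ V ⌊Real.log (u / m)⌋₊ then r m else 0) ≤
      w2 * (A * Real.log 4 * Real.exp 1 * A * Ki * u) := by
    calc _ = ∑ j ∈ Finset.Icc 1 ⌊w2⌋₊, ∑ m ∈ D.filter (fun m : ℕ => ⌊Real.log (u / m)⌋₊ = j),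
          A * Real.log 4 * Real.exp ((⌊Real.log (u / m)⌋₊ : ℝ) + 1) *
          (if k - f m ∈ V ⌊Real.log (u / m)⌋₊ then r m else 0) := by
          rw [Finset.sum_fiberwise_of_maps_to]
          intro m hm
          obtain ⟨hm1, hm2, hm3, hm4⟩ := hjf m hm
          exact Finset.mem_Icc.2 ⟨hm4, Nat.le_floor hm2⟩
      _ ≤ ∑ j ∈ Finset.Icc 1 ⌊w2⌋₊, A * Real.log 4 * Real.exp 1 * A * Ki * u := by
          apply Finset.sum_le_sum
          intro j hj
          obtain ⟨hj1, hj2⟩ := Finset.mem_Icc.1 hj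
          have hjw : (j : ℝ) ≤ w2 := (Nat.le_floor_iff hw2).1 hj2
          by_cases hjw1 : w1 < j + 1
          · calc _ ≤ ∑ m ∈ fri y (u / Real.exp j), A * Real.log 4 * Real.exp (j + 1) *
                    (if k - f m ∈ V j then r m else 0) := by
                  refine sum_le_sum_inj _ _ _ _ (fun m => m) ?_ ?_ ?_ ?_
                  · intro m hm
                    obtain ⟨hm1, hm2⟩ := Finset.mem_filter.1 hm
                    have := (block_facts y u hu m (hjf m hm1).1).2.2
                    rwa [hm2] at this
                  · intro a _ b _ h; exact h
                  · intro m hm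
                    obtain ⟨hm1, hm2⟩ := Finset.mem_filter.1 hm
                    rw [hm2]
                  · intro m _
                    have h5 := hr0 m
                    split_ifs <;> positivity
              _ = A * Real.log 4 * Real.exp (j + 1) * ∑ m ∈ fri y (u / Real.exp j),
                    (if k - f m ∈ V j then r m else 0) := by rw [Finset.mul_sum]
              _ ≤ A * Real.log 4 * Real.exp (j + 1) * ((V j).card * (Ki * (u / Real.exp j))) := by
                  apply mul_le_mul_of_nonneg_left _ (by positivity)
                  exact sum_mem_V _ f r (V j) k _ (hKi j hj1 hjw)
              _ ≤ A * Real.log 4 * Real.exp (j + 1) * (A * (Ki * (u / Real.exp j))) := by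
                  have := hV1 j hjw hjw1
                  gcongr
              _ = _ := by
                  rw [Real.exp_add]
                  field_simp
          · have : D.filter (fun m : ℕ => ⌊Real.log (u / m)⌋₊ = j) = ∅ := by
              rw [Finset.filter_eq_empty_iff]
              intro m hm h
              have := (hjf m hm).2.2.1
              rw [h] at this
              exact hjw1 this
            rw [this, Finset.sum_empty]
            positivity
      _ = ⌊w2⌋₊ * (A * Real.log 4 * Real.exp 1 * A * Ki * u) := by
          rw [Finset.sum_const, Nat.card_Icc, nsmul_eq_mul]; simp
      _ ≤ _ := by
          have := Nat.floor_le hw2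
          gcongr
  calc _ ≤ ∑ m ∈ D, (A * Real.log 4 * tau * u * (r m / m) + A * Real.log 4 *
        Real.exp ((⌊Real.log (u / m)⌋₊ : ℝ) + 1) *
        (if k - f m ∈ V ⌊Real.log (u / m)⌋₊ then r m else 0)) := Finset.sum_le_sum hpt
    _ = A * Real.log 4 * tau * u * ∑ m ∈ D, (r m / m) + ∑ m ∈ D, A * Real.log 4 *
        Real.exp ((⌊Real.log (u / m)⌋₊ : ℝ) + 1) *
        (if k - f m ∈ V ⌊Real.log (u / m)⌋₊ then r m else 0) := by
        rw [Finset.sum_add_distrib, Finset.mul_sum]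
    _ ≤ _ := by
        apply add_le_add _ hfib
        apply mul_le_mul_of_nonneg_left _ (by positivity)
        refine le_trans (Finset.sum_le_sum_of_subset_of_nonneg (Finset.filter_subset _ _) ?_) hT
        intro m _ _
        exact hnn m


lemma stepL (y u : ℝ) (hy : 2 ≤ y) (hu : 0 < u) (f r : ℕ → ℝ)
    (hf : ∀ m n : ℕ, Nat.Coprime m n → f (m * n) = f m + f n)
    (hr0 : ∀ n, 0 ≤ r n)
    (hrm : ∀ m n : ℕ, Nat.Coprime m n → r (m * n) = r m * r n)
    (A : ℝ) (hA0 : 0 ≤ A) (hrA : ∀ p : ℕ, p.Prime → (p : ℝ) ≤ y → r p ≤ A)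
    (hA : ∀ N : ℕ, ∑ p ∈ primesBelow y, ∑ ν ∈ Finset.Icc 2 N,
      r (p ^ ν) * Real.log ((p : ℝ) ^ ν) / (p : ℝ) ^ ν ≤ A)
    (T Lam : ℝ) (hT : ∑ m ∈ fri y u, r m / m ≤ T)
    (hLam : ∀ k : ℝ, ∑ m ∈ (fri y u).filter (fun m => f m = k), r m / m ≤ Lam)
    (hLam0 : 0 ≤ Lam)
    (zl L : ℝ) (I0 : ℕ) (hzl1 : 1 ≤ zl) (hLdef : L = min (Real.log u) (Real.log y))
    (hzL : Real.exp 1 * zl ≤ Real.exp (-(I0 : ℝ)) * L) (hdel : Real.exp (-(I0 : ℝ)) ≤ 1 / 2)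
    (hval : ∀ s : ℝ, zl ≤ s → s ≤ Real.log y → ∃ V : Finset ℝ, (V.card : ℝ) ≤ A ∧
      ∀ p : ℕ, p.Prime → Real.exp s < (p : ℝ) → (p : ℝ) ≤ Real.exp (Real.exp 1 * s) → f p ∈ V)
    (Kc Ki : ℝ) (hKc0 : 0 ≤ Kc) (hKi0 : 0 ≤ Ki)
    (hKc : ∀ j : ℕ, (j : ℝ) ≤ Real.exp 1 * zl →
      ∑ m ∈ fri y (u / Real.exp j), r m ≤ Kc * (u / Real.exp j))
    (hKi : ∀ j : ℕ, 1 ≤ j → (j : ℝ) ≤ Real.exp (-(I0 : ℝ)) * L → ∀ k' : ℝ,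
      ∑ m ∈ (fri y (u / Real.exp j)).filter (fun m => f m = k'), r m ≤ Ki * (u / Real.exp j))
    (k : ℝ) :
    (∑ n ∈ (fri y u).filter (fun n => f n = k), r n) * Real.log u ≤
      2 * (A * Real.log 4 * Real.exp (1 - zl) * u * T)
      + A * Real.log 4 * u * ((I0 + 1) * A * Lam)
      + Real.exp (-(I0 : ℝ)) * L * (A * Real.log 4 * Real.exp 1 * A * Ki * u)
      + A * Real.log 4 * (Real.exp 1 * zl + 1) * Real.exp 1 * Kc * u + (A + 1) * u * Lam := by
  have he : (2:ℝ) < Real.exp 1 := by have := Real.exp_one_gt_d9; linarith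
  have he0 : (0:ℝ) < Real.exp 1 := by linarith
  have hy0 : 0 ≤ y := by linarith
  set δ := Real.exp (-(I0 : ℝ)) with hδ
  have hδ0 : 0 < δ := Real.exp_pos _
  have hL0 : 0 < L := by
    by_contra h
    have : δ * L ≤ 0 := mul_nonpos_of_nonneg_of_nonpos hδ0.le (by linarith)
    nlinarith
  have hLy : L ≤ Real.log y := by rw [hLdef]; exact min_le_right _ _
  have hlog4 : 0 ≤ Real.log 4 := Real.log_nonneg (by norm_num)
  have hI : Real.exp (-((I0 + 1 : ℕ) : ℝ)) = δ / Real.exp 1 := by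
    rw [hδ, ← Real.exp_sub]; congr 1; push_cast; ring
  have hδe : δ / Real.exp 1 * L = δ * L / Real.exp 1 := by ring
  have hzl' : zl ≤ δ / Real.exp 1 * L := by
    rw [hδe, le_div_iff₀ he0]; linarith
  obtain ⟨V, hVc, hV⟩ := valset_iter f A zl (Real.log y) L (by linarith) hLy hval (I0 + 1)
    (by rw [hI]; exact hzl')
  rw [hI] at hV
  have h0 := logdec y u hu f r hf hr0 hrm A hA Lam hLam k
  have hinv : Real.exp 1 * (δ * L / Real.exp 1) = δ * L := by field_simp
  have hdd : 0 < δ * L / Real.exp 1 := by positivity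
  have hPA := partA y u hy0 hu f r hr0 A hA0 hrA T Lam hT hLam
    (Real.exp (δ / Real.exp 1 * L)) (Real.exp (1 - zl)) (Real.exp (δ * L))
    (Real.exp_pos _).le (Real.exp_pos _).le
    (by
      rw [← Real.exp_add]
      apply Real.exp_le_exp.2
      rw [hδe] at *
      nlinarith)
    V (by
      intro p hp h1 h2
      apply hV p hp h1
      have hp0 : (0:ℝ) < p := by exact_mod_cast hp.pos
      rw [← Real.log_le_iff_le_exp hp0, hLdef]
      exact le_min (Real.log_le_log hp0 (h2.trans (min_le_left _ _)))
        (Real.log_le_log hp0 (h2.trans (min_le_right _ _)))) k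
  have hPB := partB y u hy0 hu f r hr0 A hA0 hrA T hT (Real.exp 1 * zl) (δ * L) Ki
    (Real.exp (1 - zl)) (by nlinarith) (by positivity) hKi0 (Real.exp_pos _).le
    (by
      intro j hj1 hj2
      obtain ⟨W, hW1, hW2⟩ := hval ((j + 1) / Real.exp 1)
        (by rw [le_div_iff₀ he0]; linarith)
        (by
          rw [div_le_iff₀ he0]
          nlinarith)
      refine ⟨W, hW1, fun p hp h1 h2 => hW2 p hp h1 ?_⟩
      have : Real.exp 1 * (((j:ℝ) + 1) / Real.exp 1) = j + 1 := by field_simp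
      rw [this]; exact h2)
    (by
      intro j hj
      rw [← Real.exp_add]
      apply Real.exp_le_exp.2
      rw [div_le_iff₀ he0]
      nlinarith) hKi k
  have hPC := partC y u hy0 hu f r hr0 A hA0 hrA (Real.exp 1 * zl) Kc (by positivity) hKc0 hKc k
  have hterm : ∀ m ∈ fri y u, 0 ≤ r m * ∑ p ∈ (primesBelow (min (u / m) y)).filter
        (fun p => f p + f m = k), r p * Real.log p := by
    intro m _
    apply mul_nonneg (hr0 _)
    apply Finset.sum_nonneg
    intro p _
    exact mul_nonneg (hr0 _) (Real.log_natCast_nonneg p)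
  have hsplit : ∑ m ∈ fri y u, r m * ∑ p ∈ (primesBelow (min (u / m) y)).filter
        (fun p => f p + f m = k), r p * Real.log p ≤
      ∑ m ∈ (fri y u).filter (fun m : ℕ => Real.exp (δ * L) ≤ u / m), r m *
        ∑ p ∈ (primesBelow (min (u / m) y)).filter (fun p => f p + f m = k), r p * Real.log p
      + ∑ m ∈ (fri y u).filter (fun m : ℕ => Real.exp (Real.exp 1 * zl) ≤ u / m ∧
          u / m < Real.exp (δ * L)), r m *
        ∑ p ∈ (primesBelow (min (u / m) y)).filter (fun p => f p + f m = k), r p * Real.log p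
      + ∑ m ∈ (fri y u).filter (fun m : ℕ => u / m < Real.exp (Real.exp 1 * zl)), r m *
        ∑ p ∈ (primesBelow (min (u / m) y)).filter (fun p => f p + f m = k), r p * Real.log p := by
    rw [Finset.sum_filter, Finset.sum_filter, Finset.sum_filter, ← Finset.sum_add_distrib,
      ← Finset.sum_add_distrib]
    apply Finset.sum_le_sum
    intro m hm
    have h := hterm m hm
    by_cases h1 : Real.exp (δ * L) ≤ u / m
    · rw [if_pos h1]
      have h2 : ∀ (P : Prop) [Decidable P] (v : ℝ), 0 ≤ v → 0 ≤ (if P then v else 0) := by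
        intro P _ v hv; split_ifs <;> simp [hv]
      have := h2 (Real.exp (Real.exp 1 * zl) ≤ u / m ∧ u / m < Real.exp (δ * L)) _ h
      have := h2 (u / m < Real.exp (Real.exp 1 * zl)) _ h
      linarith
    · by_cases h3 : Real.exp (Real.exp 1 * zl) ≤ u / m
      · rw [if_neg h1, if_pos ⟨h3, not_le.1 h1⟩, if_neg (not_lt.2 h3)]; simp
      · rw [if_neg h1, if_neg (fun h => h3 h.1), if_pos (not_le.1 h3)]; simp
  have hVL : A * Real.log 4 * u * (V.card * Lam) ≤ A * Real.log 4 * u * ((I0 + 1) * A * Lam) := by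
    apply mul_le_mul_of_nonneg_left _ (by positivity)
    apply mul_le_mul_of_nonneg_right _ hLam0
    push_cast at hVc
    exact hVc
  linarith

set_option maxHeartbeats 800000 in
lemma indL (y : ℝ) (hy : 2 ≤ y) (f r : ℕ → ℝ)
    (hf : ∀ m n : ℕ, Nat.Coprime m n → f (m * n) = f m + f n)
    (hr0 : ∀ n, 0 ≤ r n)
    (hrm : ∀ m n : ℕ, Nat.Coprime m n → r (m * n) = r m * r n)
    (A : ℝ) (hA0 : 0 ≤ A) (hrA : ∀ p : ℕ, p.Prime → (p : ℝ) ≤ y → r p ≤ A)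
    (hA : ∀ N : ℕ, ∑ p ∈ primesBelow y, ∑ ν ∈ Finset.Icc 2 N,
      r (p ^ ν) * Real.log ((p : ℝ) ^ ν) / (p : ℝ) ^ ν ≤ A)
    (Th G K1 K3 K5 D Q zl : ℝ) (hK1 : 0 ≤ K1) (hG : 0 ≤ G) (hTh : 0 ≤ Th) (hD : 0 ≤ D)
    (hK3 : K3 = A * Real.log 4 + A + 1)
    (hT : ∀ u, ∑ m ∈ fri y u, r m / m ≤ Th)
    (hLam : ∀ u k : ℝ, ∑ m ∈ (fri y u).filter (fun m => f m = k), r m / m ≤ K1 * G)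
    (I0 : ℕ) (hzl1 : 1 ≤ zl) (hQ : Q ≤ Real.log y)
    (hzQ : Real.exp 1 * zl ≤ Real.exp (-(I0 : ℝ)) * Q) (hdel : Real.exp (-(I0 : ℝ)) ≤ 1 / 2)
    (hdel2 : 4 * (A * Real.log 4) * Real.exp 1 * A * Real.exp (-(I0 : ℝ)) ≤ 1)
    (hval : ∀ s : ℝ, zl ≤ s → s ≤ Real.log y → ∃ V : Finset ℝ, (V.card : ℝ) ≤ A ∧
      ∀ p : ℕ, p.Prime → Real.exp s < (p : ℝ) → (p : ℝ) ≤ Real.exp (Real.exp 1 * s) → f p ∈ V)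
    (hE1 : Real.exp (1 - zl) * Th ≤ Real.exp 1 * K5 * G)
    (hE2 : zl * Th ≤ K5 * Q * G)
    (hbase : ∀ u : ℝ, 2 ≤ u → Real.log u ≤ Q → ∀ k : ℝ,
      (∑ n ∈ (fri y u).filter (fun n => f n = k), r n) * Real.log u ≤ D * G * u)
    (hDK : 2 * (2 * (A * Real.log 4) * Real.exp 1 * K5 + A * Real.log 4 * (I0 + 1) * A * K1
      + 2 * (A * Real.log 4) * (Real.exp 1 + 1) * Real.exp 1 * K3 * K5 + (A + 1) * K1) ≤ D)
    (n : ℕ) : ∀ u : ℝ, 2 ≤ u → Real.log u ≤ n → ∀ k : ℝ,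
      (∑ n ∈ (fri y u).filter (fun n => f n = k), r n) * Real.log u ≤ D * G * u := by
  have he : (2:ℝ) < Real.exp 1 := by have := Real.exp_one_gt_d9; linarith
  have he0 : (0:ℝ) < Real.exp 1 := by linarith
  have hlog4 : 0 ≤ Real.log 4 := Real.log_nonneg (by norm_num)
  have hlog2 : Real.log 2 < 1 := by have := Real.log_two_lt_d9; linarith
  induction n with
  | zero =>
    intro u hu hlu
    have := Real.log_pos (show (1:ℝ) < u by linarith)
    norm_num at hlu; linarith
  | succ n ih =>
    intro u hu hlu k
    by_cases hb : Real.log u ≤ Q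
    · exact hbase u hu hb k
    have hu0 : 0 < u := by linarith
    push Not at hb
    have hδ0 : 0 < Real.exp (-(I0 : ℝ)) := Real.exp_pos _
    have hQ0 : 0 < Q := by
      by_contra h
      have : Real.exp (-(I0 : ℝ)) * Q ≤ 0 :=
        mul_nonpos_of_nonneg_of_nonpos hδ0.le (by linarith)
      nlinarith
    have hlu0 : 0 < Real.log u := by linarith
    set δ := Real.exp (-(I0 : ℝ)) with hδ
    set L := min (Real.log u) (Real.log y) with hLdef
    have hLQ : Q ≤ L := le_min hb.le hQ
    have hLu : L ≤ Real.log u := min_le_left _ _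
    have hzh : Real.exp 1 * zl ≤ Real.log u / 2 := by nlinarith
    have hLh : δ * L ≤ Real.log u / 2 := by nlinarith
    have hB : 2 < Real.log u / 2 := by nlinarith
    have hju : ∀ j : ℕ, (j:ℝ) ≤ Real.log u / 2 →
        Real.log (u / Real.exp j) = Real.log u - j := by
      intro j _
      rw [Real.log_div hu0.ne' (Real.exp_pos _).ne', Real.log_exp]
    have hj2 : ∀ j : ℕ, (j:ℝ) ≤ Real.log u / 2 → 2 ≤ u / Real.exp j := by
      intro j hj
      have hpos : 0 < u / Real.exp j := by positivity
      rw [← Real.log_le_log_iff (by norm_num) hpos, hju j hj]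
      linarith
    have key : ∀ (j : ℕ) (S K : ℝ), (j:ℝ) ≤ Real.log u / 2 → 0 ≤ S →
        S * Real.log (u / Real.exp j) ≤ K * (u / Real.exp j) →
        S ≤ 2 * K / Real.log u * (u / Real.exp j) := by
      intro j S K hj hS h
      rw [hju j hj] at h
      have h1 : S * (Real.log u / 2) ≤ S * (Real.log u - j) :=
        mul_le_mul_of_nonneg_left (by linarith) hS
      have h2 : 2 * K / Real.log u * (u / Real.exp j)
        = (K * (u / Real.exp j)) / (Real.log u / 2) := by field_simp
      rw [h2, le_div_iff₀ (by linarith)]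
      linarith
    have hK30 : 0 ≤ K3 := by rw [hK3]; positivity
    have hst := stepL y u hy hu0 f r hf hr0 hrm A hA0 hrA hA Th (K1 * G) (hT u) (hLam u)
      (by positivity) zl L I0 hzl1 hLdef (hzQ.trans (mul_le_mul_of_nonneg_left hLQ hδ0.le))
      hdel hval (2 * (K3 * Th) / Real.log u) (2 * (D * G) / Real.log u)
      (by positivity) (by positivity)
      (by
        intro j hj
        apply key j _ _ (hj.trans hzh) (Finset.sum_nonneg fun _ _ => hr0 _)
        have := triv y (u / Real.exp j) (by linarith) (by positivity) r hr0 hrm A hA0 hrA hA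
          Th (hT _)
        rw [hK3]; linarith)
      (by
        intro j hj1 hj k'
        have hj' := hj.trans hLh
        apply key j _ _ hj' (Finset.sum_nonneg fun _ _ => hr0 _)
        apply ih _ (hj2 j hj')
        rw [hju j hj']
        have : (1:ℝ) ≤ j := by exact_mod_cast hj1
        push_cast at hlu
        linarith) k
    -- arithmetic
    have t1 : 2 * (A * Real.log 4 * Real.exp (1 - zl) * u * Th) ≤
        2 * (A * Real.log 4) * Real.exp 1 * K5 * (G * u) := by
      have := mul_le_mul_of_nonneg_left hE1 (show 0 ≤ 2 * (A * Real.log 4) * u by positivity)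
      linarith
    have t3 : δ * L * (A * Real.log 4 * Real.exp 1 * A * (2 * (D * G) / Real.log u) * u)
        ≤ D / 2 * (G * u) := by
      have h1 : δ * L * (A * Real.log 4 * Real.exp 1 * A * (2 * (D * G) / Real.log u) * u)
        = (4 * (A * Real.log 4) * Real.exp 1 * A * δ) * (L / Real.log u) * (D / 2 * (G * u)) := by
        field_simp; ring
      rw [h1]
      have h2 : L / Real.log u ≤ 1 := by rw [div_le_one hlu0]; exact hLu
      have h3 : 0 ≤ L / Real.log u := div_nonneg (by linarith) hlu0.le
      have h4 := mul_le_one₀ hdel2 h3 h2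
      have h5 : 0 ≤ D / 2 * (G * u) := by positivity
      calc _ ≤ 1 * (D / 2 * (G * u)) := mul_le_mul_of_nonneg_right h4 h5
        _ = _ := one_mul _
    have t4 : A * Real.log 4 * (Real.exp 1 * zl + 1) * Real.exp 1 * (2 * (K3 * Th) / Real.log u) * u
        ≤ 2 * (A * Real.log 4) * (Real.exp 1 + 1) * Real.exp 1 * K3 * K5 * (G * u) := by
      have h1 : (Real.exp 1 * zl + 1) * Th ≤ (Real.exp 1 + 1) * (K5 * Q * G) := by
        have : (Real.exp 1 * zl + 1) * Th ≤ (Real.exp 1 + 1) * (zl * Th) := by nlinarith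
        nlinarith
      have hKQ : 0 ≤ K5 * Q * G := le_trans (by positivity) hE2
      have hK5G : 0 ≤ K5 * G := by
        by_contra h
        push Not at h
        nlinarith
      have h2 : (Real.exp 1 * zl + 1) * Th / Real.log u ≤ (Real.exp 1 + 1) * (K5 * G) := by
        rw [div_le_iff₀ hlu0]
        have : K5 * G * Q ≤ K5 * G * Real.log u := mul_le_mul_of_nonneg_left hb.le hK5G
        nlinarith
      have h3 := mul_le_mul_of_nonneg_left h2
        (show 0 ≤ 2 * (A * Real.log 4) * Real.exp 1 * K3 * u by positivity)
      calc _ = 2 * (A * Real.log 4) * Real.exp 1 * K3 * u *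
            ((Real.exp 1 * zl + 1) * Th / Real.log u) := by ring
        _ ≤ _ := h3
        _ = _ := by ring
    have hGu : 0 ≤ G * u := by positivity
    have t6 := mul_le_mul_of_nonneg_right hDK hGu
    clear hE1 hE2 hDK hdel2 hzQ hval hbase ih key hj2 hju
    linarith

set_option maxHeartbeats 2000000 in
lemma fin_aux (b A lam : ℝ) (hb : 0 < b) (hA : 0 < A) (hlam0 : 0 < lam) (hlam1 : lam < 1) :
    ∃ c : ℝ, 0 < c ∧ ∀ (C x y : ℝ) (f r : ℕ → ℝ), 1 ≤ C → 2 ≤ y → y ≤ x →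
        (∀ m n : ℕ, Nat.Coprime m n → f (m * n) = f m + f n) →
        (∀ t : ℝ, Real.exp ((Real.log y) ^ (1 - lam)) ≤ t → t ≤ y →
          (({v : ℝ | ∃ p : ℕ, p.Prime ∧ t < (p : ℝ) ∧ (p : ℝ) ≤ t ^ (Real.exp 1) ∧
            f p = v}).ncard : ℝ) ≤ A) →
        (∀ n, 0 ≤ r n) → r 1 = 1 →
        (∀ m n : ℕ, Nat.Coprime m n → r (m * n) = r m * r n) →
        (∀ p : ℕ, p.Prime → (p : ℝ) ≤ y → r p ≤ A) →
        (∀ N : ℕ, ∑ p ∈ primesBelow y, ∑ ν ∈ Finset.Icc 2 N,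
          r (p ^ ν) * Real.log ((p : ℝ) ^ ν) / (p : ℝ) ^ ν ≤ A) →
        (∀ t : ℝ, 2 ≤ t → t ≤ y →
          |(∑ p ∈ primesBelow t, r p / p) - b * Real.log (Real.log t)| ≤ C) →
        ∀ k : ℝ,
          (∑ n ∈ (fri y x).filter (fun n => f n = k), r n) * Real.log x ≤
            c * ((Real.log y) ^ b * Real.exp (2 * C) / Real.sqrt (Ef f y r)) * x := by
  have he : (2:ℝ) < Real.exp 1 := by have := Real.exp_one_gt_d9; linarith
  have he0 : (0:ℝ) < Real.exp 1 := by linarith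
  have hlog4 : 0 < Real.log 4 := Real.log_pos (by norm_num)
  obtain ⟨I0, hI0⟩ := exists_nat_ge (max 1 (4 * (A * Real.log 4) * Real.exp 1 * A))
  have hI1 := (le_max_left _ _).trans hI0
  have hI2 := (le_max_right _ _).trans hI0
  set δ := Real.exp (-(I0 : ℝ)) with hδ
  have hδ0 : 0 < δ := Real.exp_pos _
  have hδI : δ * (I0 + 1) ≤ 1 := by
    have h1 : δ * Real.exp I0 = 1 := by rw [hδ, ← Real.exp_add]; simp
    have h2 := Real.add_one_le_exp (I0 : ℝ)
    nlinarith
  have hdel : δ ≤ 1 / 2 := by nlinarith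
  have hdel2 : 4 * (A * Real.log 4) * Real.exp 1 * A * δ ≤ 1 := by
    have := mul_le_mul_of_nonneg_right hI2 hδ0.le
    nlinarith
  obtain ⟨η, hη0, hη1, hη2, hη3⟩ : ∃ η : ℝ, 0 < η ∧ η ≤ lam / 2 ∧ η ≤ 1 - lam ∧ η ≤ b * lam / 2 :=
    ⟨min (lam / 2) (min (1 - lam) (b * lam / 2)),
      lt_min (by linarith) (lt_min (by linarith) (by positivity)), min_le_left _ _,
      (min_le_right _ _).trans (min_le_left _ _), (min_le_right _ _).trans (min_le_right _ _)⟩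
  set K1 := 2 * Real.exp A with hK1
  have hK10 : 0 < K1 := by positivity
  set K3 := A * Real.log 4 + A + 1 with hK3
  have hK30 : 0 < K3 := by positivity
  set K5 := K1 * (1 + b / η) with hK5
  have hK50 : 0 < K5 := by positivity
  set M0 := Real.exp 1 / δ with hM0
  have hM00 : 0 < M0 := by positivity
  have hM01 : 1 ≤ M0 := by rw [hM0, le_div_iff₀ hδ0]; linarith
  set D := 2 * (2 * (A * Real.log 4) * Real.exp 1 * K5 + A * Real.log 4 * (I0 + 1) * A * K1
      + 2 * (A * Real.log 4) * (Real.exp 1 + 1) * Real.exp 1 * K3 * K5 + (A + 1) * K1)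
      + K3 * K5 with hD
  have hD0 : 0 < D := by positivity
  set c0 := K3 * (K1 * (1 + b * (M0 / (lam / 2)))) with hc0
  have hc00 : 0 < c0 := by positivity
  refine ⟨c0 + D, by positivity, ?_⟩
  intro C x y f r hC hy hyx hf hval hr0 hr1 hrm hrA hAl hmert k
  set l := Real.log y with hl
  have hl0 : 0 < l := Real.log_pos (by linarith)
  have hE1 : 1 ≤ Ef f y r := by
    unfold Ef
    have : 0 ≤ ∑ p ∈ (primesBelow y).filter (fun p => f p ≠ 0), r p / p :=
      Finset.sum_nonneg fun p _ => div_nonneg (hr0 _) (Nat.cast_nonneg _)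
    linarith
  have hPS : ∀ w, 2 ≤ w → w ≤ y →
      ∑ p ∈ primesBelow w, r p / p ≤ b * Real.log (Real.log w) + C := by
    intro w h1 h2
    have := (abs_le.1 (hmert w h1 h2)).2
    linarith
  have hEu : Ef f y r ≤ 1 + b * Real.log l + C := by
    have h1 := hPS y hy le_rfl
    have h2 : ∑ p ∈ (primesBelow y).filter (fun p => f p ≠ 0), r p / p ≤
        ∑ p ∈ primesBelow y, r p / p :=
      Finset.sum_le_sum_of_subset_of_nonneg (Finset.filter_subset _ _)
        fun p _ _ => div_nonneg (hr0 _) (Nat.cast_nonneg _)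
    unfold Ef
    linarith
  set S := Real.sqrt (Ef f y r) with hS
  have hS1 : 1 ≤ S := Real.one_le_sqrt.2 hE1
  have hSE : S ≤ Ef f y r := by
    have := Real.mul_self_sqrt (show 0 ≤ Ef f y r by linarith)
    nlinarith
  have hexpS : ∀ w, 2 ≤ w → w ≤ y →
      Real.exp (∑ p ∈ primesBelow w, r p / p) ≤ Real.exp C * (Real.log w) ^ b := by
    intro w h1 h2
    have hw0 : 0 < Real.log w := Real.log_pos (by linarith)
    rw [Real.rpow_def_of_pos hw0, ← Real.exp_add]
    apply Real.exp_le_exp.2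
    have := hPS w h1 h2
    linarith
  have hsub : ∀ w, w ≤ y → primesBelow w ⊆ primesBelow y := by
    intro w hw p hp
    rw [mem_primesBelow] at hp ⊢
    exact ⟨hp.1, hp.2.trans hw⟩
  have hAlw : ∀ w, w ≤ y → ∀ N : ℕ, ∑ p ∈ primesBelow w, ∑ ν ∈ Finset.Icc 2 N,
          r (p ^ ν) * Real.log ((p : ℝ) ^ ν) / (p : ℝ) ^ ν ≤ A := by
    intro w hw N
    refine le_trans ?_ (hAl N)
    apply Finset.sum_le_sum_of_subset_of_nonneg (hsub w hw)
    intro p _ _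
    apply Finset.sum_nonneg
    intro ν _
    have h := Real.log_natCast_nonneg (p ^ ν)
    push_cast at h
    exact div_nonneg (mul_nonneg (hr0 _) h) (by positivity)
  have hAn : ∀ w, w ≤ y → ∀ N : ℕ, ∑ p ∈ primesBelow w, ∑ ν ∈ Finset.Icc 2 N,
          r (p ^ ν) / (p : ℝ) ^ ν ≤ A := by
    intro w hw N
    refine le_trans ?_ (hAlw w hw N)
    apply Finset.sum_le_sum
    intro p hp
    apply Finset.sum_le_sum
    intro ν hν
    have hp2 : (2:ℝ) ≤ p := by exact_mod_cast (mem_primesBelow.1 hp).1.two_le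
    have hν2 := (Finset.mem_Icc.1 hν).1
    have h4 : Real.exp 1 ≤ (p:ℝ) ^ ν := by
      have h5 : (2:ℝ) ^ 2 ≤ (p:ℝ) ^ ν :=
        (pow_le_pow_right₀ (by norm_num) hν2).trans (pow_le_pow_left₀ (by norm_num) hp2 _)
      have := Real.exp_one_lt_d9
      linarith
    have h6 : 1 ≤ Real.log ((p:ℝ) ^ ν) := by
      rw [Real.le_log_iff_exp_le (by positivity)]; exact h4
    apply div_le_div_of_nonneg_right _ (by positivity)
    exact le_mul_of_one_le_right (hr0 _) h6
  have hTw : ∀ w u, 2 ≤ w → w ≤ y →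
      ∑ m ∈ fri w u, r m / m ≤ K1 * (Real.exp C * (Real.log w) ^ b) := by
    intro w u h1 h2
    have h := ac w u (fun _ => 0) r (by simp) hr0 hr1 hrm A (hAn w h2) 0
    simp only [Finset.filter_true, Ef, ne_eq, not_true_eq_false, Finset.filter_false,
      Finset.sum_empty, add_zero, Real.sqrt_one, div_one] at h
    exact h.trans (mul_le_mul_of_nonneg_left (hexpS w h1 h2) hK10.le)
  set G := l ^ b * Real.exp (2 * C) / S with hG
  have hlb : 0 < l ^ b := Real.rpow_pos_of_pos hl0 _
  have hG0 : 0 < G := by positivity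
  have hLam : ∀ u k : ℝ, ∑ m ∈ (fri y u).filter (fun m => f m = k), r m / m ≤ K1 * G := by
    intro u k
    refine (ac y u f r hf hr0 hr1 hrm A (hAn y le_rfl) k).trans ?_
    rw [hG, ← mul_div_assoc]
    apply div_le_div_of_nonneg_right _ (by linarith)
    apply mul_le_mul_of_nonneg_left _ hK10.le
    refine (hexpS y hy le_rfl).trans ?_
    rw [mul_comm]
    apply mul_le_mul_of_nonneg_left _ hlb.le
    exact Real.exp_le_exp.2 (by linarith)
  set Th := K1 * (Real.exp C * l ^ b) with hTh
  have hTh0 : 0 < Th := by positivity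
  have hThX : ∀ X, 0 ≤ X → Real.log l ≤ X → Th ≤ K1 * (1 + b * X) * G := by
    intro X hX hlX
    have h1 : S ≤ Real.exp C * (1 + b * X) := by
      have h2 : b * Real.log l ≤ b * X := mul_le_mul_of_nonneg_left hlX hb.le
      have h3 := Real.add_one_le_exp C
      have h4 : 0 ≤ b * X := by positivity
      nlinarith
    have h5 : G = l ^ b * Real.exp C * Real.exp C / S := by
      rw [hG, two_mul, Real.exp_add, mul_assoc]
    rw [h5, ← mul_div_assoc, le_div_iff₀ (by linarith), hTh]
    have := mul_le_mul_of_nonneg_left h1 (show 0 ≤ K1 * (Real.exp C * l ^ b) by positivity)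
    linarith
  have hx0 : 0 < x := by linarith
  have hGx : 0 ≤ G * x := by positivity
  have hsum_le : ∀ u, ∑ n ∈ (fri y u).filter (fun n => f n = k), r n ≤ ∑ n ∈ fri y u, r n :=
    fun u => Finset.sum_le_sum_of_subset_of_nonneg (Finset.filter_subset _ _) fun n _ _ => hr0 n
  by_cases hbig : l ^ (lam / 2) < M0
  · -- small y
    have h1 : Real.log l ≤ M0 / (lam / 2) := by
      refine (Real.log_le_rpow_div hl0.le (show 0 < lam / 2 by linarith)).trans ?_
      exact div_le_div_of_nonneg_right hbig.le (by linarith)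
    have h2 := hThX _ (by positivity) h1
    have h3 := triv y x (by linarith) hx0 r hr0 hrm A hA.le hrA hAl Th (hTw y x hy le_rfl)
    have hlx : 0 ≤ Real.log x := Real.log_nonneg (by linarith)
    have h4 := mul_le_mul_of_nonneg_right (hsum_le x) hlx
    have h5 := mul_le_mul_of_nonneg_left h2 (show 0 ≤ K3 * x by positivity)
    have h6 : 0 ≤ D * (G * x) := by positivity
    have h7 : c0 * (G * x) = K3 * x * (K1 * (1 + b * (M0 / (lam / 2))) * G) := by rw [hc0]; ring
    linarith
  · push Not at hbig
    have hl1 : 1 ≤ l := by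
      by_contra h
      push Not at h
      have := Real.rpow_lt_one hl0.le h (show 0 < lam / 2 by linarith)
      linarith
    have hThη : Th ≤ K5 * l ^ η * G := by
      have h1 := hThX (l ^ η / η) (by positivity) (Real.log_le_rpow_div hl0.le hη0)
      refine h1.trans ?_
      apply mul_le_mul_of_nonneg_right _ hG0.le
      have h2 : 1 ≤ l ^ η := Real.one_le_rpow hl1 hη0.le
      rw [hK5, mul_assoc K1 (1 + b / η) (l ^ η)]
      apply mul_le_mul_of_nonneg_left _ hK10.le
      have : b * (l ^ η / η) = b / η * l ^ η := by ring
      rw [this]; nlinarith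
    have hThe : ∀ e, η ≤ e → Th ≤ K5 * l ^ e * G := by
      intro e hee
      refine hThη.trans ?_
      apply mul_le_mul_of_nonneg_right _ hG0.le
      exact mul_le_mul_of_nonneg_left (Real.rpow_le_rpow_of_exponent_le hl1 hee) hK50.le
    set zl := l ^ (1 - lam) with hzl
    set Q := l ^ (1 - lam / 2) with hQ
    have hzl1 : 1 ≤ zl := Real.one_le_rpow hl1 (by linarith)
    have hQz : zl * l ^ (lam / 2) = Q := by
      rw [hzl, hQ, ← Real.rpow_add hl0]; congr 1; ring
    have hQl : Q ≤ l := by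
      have := Real.rpow_le_rpow_of_exponent_le hl1 (show 1 - lam / 2 ≤ 1 by linarith)
      rwa [Real.rpow_one] at this
    obtain ⟨n, hn⟩ := exists_nat_ge (Real.log x)
    have hmain := indL y hy f r hf hr0 hrm A hA.le hrA hAl Th G K1 K3 K5 D Q zl hK10.le hG0.le
      hTh0.le hD0.le hK3 (fun u => hTw y u hy le_rfl) hLam I0 hzl1 hQl
      (by
        rw [← hQz]
        have h1 : Real.exp 1 ≤ δ * l ^ (lam / 2) := by
          have := mul_le_mul_of_nonneg_left hbig hδ0.le
          rw [hM0, mul_div_cancel₀ _ hδ0.ne'] at this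
          exact this
        calc Real.exp 1 * zl ≤ (δ * l ^ (lam / 2)) * zl :=
              mul_le_mul_of_nonneg_right h1 (by linarith)
          _ = _ := by ring) hdel hdel2
      (by
        intro s hs1 hs2
        have h1 : Real.exp s ≤ y := by
          rw [← Real.le_log_iff_exp_le (by linarith)]; exact hs2
        obtain ⟨V, hV1, hV2⟩ := valset f A (Real.exp s) (hval _ (Real.exp_le_exp.2 hs1) h1)
        refine ⟨V, hV1, fun p hp h2 h3 => hV2 p hp h2 ?_⟩
        rw [← Real.exp_mul, mul_comm]; exact h3)
      (by
        have h1 := hThe (1 - lam) hη2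
        have h2 : zl ≤ Real.exp zl := by have := Real.add_one_le_exp zl; linarith
        rw [Real.exp_sub, div_mul_eq_mul_div, div_le_iff₀ (Real.exp_pos _)]
        have h3 : Th ≤ K5 * Real.exp zl * G := by
          refine h1.trans ?_
          apply mul_le_mul_of_nonneg_right _ hG0.le
          exact mul_le_mul_of_nonneg_left h2 hK50.le
        have h4 := mul_le_mul_of_nonneg_left h3 he0.le
        linarith)
      (by
        have h1 := mul_le_mul_of_nonneg_left (hThe (lam / 2) hη1) (show 0 ≤ zl by linarith)
        rw [← hQz]; linarith)
      (by
        intro u hu hlu k'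
        have hu0 : 0 < u := by linarith
        have huy : u ≤ y := by
          rw [← Real.log_le_log_iff hu0 (by linarith)]; linarith
        have hlu0 : 0 < Real.log u := Real.log_pos (by linarith)
        have h1 : ∑ n ∈ (fri y u).filter (fun n => f n = k'), r n ≤ ∑ n ∈ fri u u, r n := by
          apply Finset.sum_le_sum_of_subset_of_nonneg
          · intro n hn
            have h2 := mem_fri.1 (Finset.mem_filter.1 hn).1
            rw [mem_fri]
            refine ⟨h2.1, h2.2.1, fun p _ hd => ?_⟩
            have : p ≤ n := Nat.le_of_dvd h2.1 hd
            have : (p:ℝ) ≤ n := by exact_mod_cast this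
            linarith [h2.2.1]
          · intro n _ _; exact hr0 n
        have h2 := triv u u hu0.le hu0 r hr0 hrm A hA.le
          (fun p hp h => hrA p hp (h.trans huy)) (hAlw u huy) _ (hTw u u hu huy)
        have h3 : K1 * (Real.exp C * Real.log u ^ b) ≤ K5 * G := by
          have h4 : Real.log u ^ b ≤ l ^ b / l ^ (b * lam / 2) := by
            rw [← Real.rpow_sub hl0]
            refine (Real.rpow_le_rpow hlu0.le hlu hb.le).trans ?_
            rw [hQ, ← Real.rpow_mul hl0.le]
            apply le_of_eq; congr 1; ring
          have hp : 0 < l ^ (b * lam / 2) := Real.rpow_pos_of_pos hl0 _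
          have h5 := hThe (b * lam / 2) hη3
          have h6 : Th / l ^ (b * lam / 2) ≤ K5 * G := by
            rw [div_le_iff₀ hp]; linarith
          refine le_trans ?_ h6
          calc K1 * (Real.exp C * Real.log u ^ b)
              ≤ K1 * (Real.exp C * (l ^ b / l ^ (b * lam / 2))) := by gcongr
            _ = _ := by rw [hTh]; ring
        have h7 := mul_le_mul_of_nonneg_right h1 hlu0.le
        have h8 := mul_le_mul_of_nonneg_left h3 (show 0 ≤ K3 * u by positivity)
        have h9 : K3 * K5 ≤ D := by
          rw [hD]; apply le_add_of_nonneg_left; positivity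
        have h10 := mul_le_mul_of_nonneg_right h9 (show 0 ≤ G * u by positivity)
        linarith)
      (by
        rw [hD]; apply le_add_of_nonneg_right; positivity)
      n x (by linarith) hn k
    have : 0 ≤ c0 * (G * x) := by positivity
    linarith

/-- Halász-type concentration bound with nonconstant weights (Lemma 2 of the paper):
fix `ε, b, A > 0` and `0 < λ < 1`; there is a constant `c = c(ε, b, A, λ) > 0` such that for
all `C, C' ≥ 1`, all `2 ≤ y ≤ x` with `(log y)^{ε(1−λ)} ≥ (log log x)²`, with
`z := exp((log y)^{1−λ})`, every additive `f : ℕ → ℝ` with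
`#{f(p) : t < p ≤ t^e} ≤ A` for `z ≤ t ≤ y`, and every nonnegative multiplicative `r`
satisfying the stated bounds, admitting a nonnegative multiplicative approximation `r̃`, one has
`∑_{n ∈ S(x,y), f(n) = k} r(n) ≤ c · ((log y)^b/log x) · e^{2C + C'/z} · x / √(E_f(y; r))`
for every `k ∈ ℝ`. The condition `∑_{p ≤ y, ν ≥ 2} r(pᵛ) log(pᵛ)/pᵛ ≤ A` is expressed via all
of its finite partial sums (all terms being nonnegative). -/
theorem statement2 (ε b A lam : ℝ) (hε : 0 < ε) (hb : 0 < b) (hA : 0 < A)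
    (hlam0 : 0 < lam) (hlam1 : lam < 1) :
    ∃ c : ℝ, 0 < c ∧
      ∀ (C C' x y : ℝ) (f r rt : ℕ → ℝ),
        1 ≤ C → 1 ≤ C' → 2 ≤ y → y ≤ x →
        (Real.log (Real.log x)) ^ 2 ≤ (Real.log y) ^ (ε * (1 - lam)) →
        -- `f` is additive
        (∀ m n : ℕ, Nat.Coprime m n → f (m * n) = f m + f n) →
        -- `f(p)` takes at most `A` values on each dyadic-type block `(t, t^e]`, `z ≤ t ≤ y`
        (∀ t : ℝ, Real.exp ((Real.log y) ^ (1 - lam)) ≤ t → t ≤ y →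
          (({v : ℝ | ∃ p : ℕ, p.Prime ∧ t < (p : ℝ) ∧ (p : ℝ) ≤ t ^ (Real.exp 1) ∧
            f p = v}).ncard : ℝ) ≤ A) →
        -- `r` is nonnegative and multiplicative
        (∀ n, 0 ≤ r n) → r 1 = 1 →
        (∀ m n : ℕ, Nat.Coprime m n → r (m * n) = r m * r n) →
        -- `max_{p ≤ y} r(p) ≤ A`
        (∀ p : ℕ, p.Prime → (p : ℝ) ≤ y → r p ≤ A) →
        -- `∑_{p ≤ y, ν ≥ 2} r(pᵛ) log(pᵛ)/pᵛ ≤ A`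
        (∀ N : ℕ, ∑ p ∈ primesBelow y, ∑ ν ∈ Finset.Icc 2 N,
          r (p ^ ν) * Real.log ((p : ℝ) ^ ν) / (p : ℝ) ^ ν ≤ A) →
        -- `|∑_{p ≤ t} r(p)/p − b log log t| ≤ C` for `2 ≤ t ≤ y`
        (∀ t : ℝ, 2 ≤ t → t ≤ y →
          |(∑ p ∈ primesBelow t, r p / p) - b * Real.log (Real.log t)| ≤ C) →
        -- `r̃` is nonnegative and multiplicative
        (∀ n, 0 ≤ rt n) → rt 1 = 1 →
        (∀ m n : ℕ, Nat.Coprime m n → rt (m * n) = rt m * rt n) →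
        -- `∑_{p ≤ y} |r(p) − r̃(p)|/p ≤ A`
        (∑ p ∈ primesBelow y, |r p - rt p| / p ≤ A) →
        -- `|∑_{p ≤ t} r̃(p) − b Li(t)| ≤ A(C' + t/(log t)^{1+ε})` for `2 ≤ t ≤ y`
        (∀ t : ℝ, 2 ≤ t → t ≤ y →
          |(∑ p ∈ primesBelow t, rt p) - b * Li t| ≤
            A * (C' + t / (Real.log t) ^ (1 + ε))) →
        ∀ k : ℝ,
          ∑ n ∈ (Finset.Icc 1 ⌊x⌋₊).filter
              (fun n => (∀ p : ℕ, p.Prime → p ∣ n → (p : ℝ) ≤ y) ∧ f n = k), r n ≤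
            c * ((Real.log y) ^ b / Real.log x) *
              Real.exp (2 * C + C' / Real.exp ((Real.log y) ^ (1 - lam))) * x /
              Real.sqrt (Ef f y r) := by
  obtain ⟨c, hc, h⟩ := fin_aux b A lam hb hA hlam0 hlam1
  refine ⟨c, hc, ?_⟩
  intro C C' x y f r rt hC hC' hy hyx _ hf hval hr0 hr1 hrm hrA hAl hmert _ _ _ _ _ k
  have h1 := h C x y f r hC hy hyx hf hval hr0 hr1 hrm hrA hAl hmert k
  have hset : (Finset.Icc 1 ⌊x⌋₊).filter
      (fun n => (∀ p : ℕ, p.Prime → p ∣ n → (p : ℝ) ≤ y) ∧ f n = k) =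
      (fri y x).filter (fun n => f n = k) := by
    ext n
    simp only [fri, Finset.mem_filter, and_assoc]
  rw [hset]
  have hx0 : 0 < x := by linarith
  have hlx : 0 < Real.log x := Real.log_pos (by linarith)
  have hl0 : 0 < Real.log y := Real.log_pos (by linarith)
  have hexp : Real.exp (2 * C) ≤
      Real.exp (2 * C + C' / Real.exp ((Real.log y) ^ (1 - lam))) := by
    apply Real.exp_le_exp.2
    have : 0 ≤ C' / Real.exp ((Real.log y) ^ (1 - lam)) := by positivity
    linarith
  rw [← le_div_iff₀ hlx] at h1
  refine h1.trans ?_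
  have h2 := mul_le_mul_of_nonneg_left hexp
    (show 0 ≤ c * (Real.log y ^ b / Real.log x) * x / Real.sqrt (Ef f y r) by positivity)
  calc _ = c * (Real.log y ^ b / Real.log x) * x / Real.sqrt (Ef f y r) * Real.exp (2 * C) := by
        ring
    _ ≤ _ := h2
    _ = _ := by ring
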